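/- arXiv:math/0609648 — 2 statements merged into one kernel-verified Lean document; each statement's English description precedes it below -/
import Mathlib

section
/- Let n ≥ 2 and α > α_n = n·ω_{n-1}^{1/(n-1)}. Then sup { ∫_{ℝ^n} Φ(α·|u|^{n/(n-1)}) dx : u ∈ H^{1,n}(ℝ^n), ∫_{ℝ^n}(|∇u|^n + |u|^n) dx ≤ 1 } = +∞, where Φ(t) = e^t - ∑_{j=0}^{n-2} t^j/j!. -/
open MeasureTheory

/-- A smooth cutoff, equal to `1` on `[2ε, 1/2]` and vanishing outside `(ε, 1)`. -/
noncomputable def annulusCutoff (ε s : ℝ) : ℝ :=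
  Real.smoothTransition ((s - ε) / ε) * Real.smoothTransition (2 * (1 - s))

lemma annulusCutoff_nonneg (ε s : ℝ) : 0 ≤ annulusCutoff ε s :=
  mul_nonneg (Real.smoothTransition.nonneg _) (Real.smoothTransition.nonneg _)

lemma annulusCutoff_le_one (ε s : ℝ) : annulusCutoff ε s ≤ 1 :=
  mul_le_one₀ (Real.smoothTransition.le_one _) (Real.smoothTransition.nonneg _)
    (Real.smoothTransition.le_one _)

lemma annulusCutoff_of_le {ε s : ℝ} (hε : 0 < ε) (hs : s ≤ ε) : annulusCutoff ε s = 0 := by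
  rw [annulusCutoff, Real.smoothTransition.zero_of_nonpos, zero_mul]
  exact div_nonpos_of_nonpos_of_nonneg (by linarith) hε.le

lemma annulusCutoff_of_one_le {ε s : ℝ} (hs : 1 ≤ s) : annulusCutoff ε s = 0 := by
  rw [annulusCutoff, Real.smoothTransition.zero_of_nonpos (x := 2 * (1 - s)), mul_zero]
  linarith

lemma annulusCutoff_eq_one {ε s : ℝ} (hε : 0 < ε) (h₁ : 2 * ε ≤ s) (h₂ : s ≤ 1 / 2) :
    annulusCutoff ε s = 1 := by
  rw [annulusCutoff, Real.smoothTransition.one_of_one_le, Real.smoothTransition.one_of_one_le,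
    one_mul]
  · linarith
  · rw [le_div_iff₀ hε]; linarith

lemma contDiff_annulusCutoff_div {ε : ℝ} (hε : 0 < ε) :
    ContDiff ℝ (⊤ : ℕ∞) fun s => annulusCutoff ε s / s := by
  rw [contDiff_iff_contDiffAt]
  intro s
  rcases lt_or_ge s ε with hs | hs
  · refine (contDiffAt_const (c := (0 : ℝ))).congr_of_eventuallyEq ?_
    filter_upwards [Iio_mem_nhds hs] with t ht
    rw [annulusCutoff_of_le hε (le_of_lt ht), zero_div]
  · refine ContDiffAt.div ?_ contDiffAt_id (by simp; linarith)
    unfold annulusCutoff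
    refine ContDiff.contDiffAt ?_
    exact (Real.smoothTransition.contDiff.comp (by fun_prop)).mul
      (Real.smoothTransition.contDiff.comp (by fun_prop))

lemma annulusCutoff_div_nonneg {ε : ℝ} (hε : 0 < ε) (s : ℝ) : 0 ≤ annulusCutoff ε s / s := by
  rcases le_total s ε with hs | hs
  · rw [annulusCutoff_of_le hε hs, zero_div]
  · exact div_nonneg (annulusCutoff_nonneg _ _) (hε.le.trans hs)

/-- A smooth truncation of `r ↦ -log r`, constant on `r ≤ ε` and vanishing for `r ≥ 1`. -/
noncomputable def truncLog (ε r : ℝ) : ℝ := ∫ s in r..1, annulusCutoff ε s / s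

lemma hasDerivAt_truncLog {ε : ℝ} (hε : 0 < ε) (r : ℝ) :
    HasDerivAt (truncLog ε) (-(annulusCutoff ε r / r)) r := by
  have hc := (contDiff_annulusCutoff_div hε).continuous
  exact intervalIntegral.integral_hasDerivAt_left (hc.intervalIntegrable _ _)
    (hc.stronglyMeasurableAtFilter _ _) hc.continuousAt

lemma contDiff_truncLog {ε : ℝ} (hε : 0 < ε) : ContDiff ℝ (⊤ : ℕ∞) (truncLog ε) := by
  rw [contDiff_infty_iff_deriv]
  refine ⟨fun r => (hasDerivAt_truncLog hε r).differentiableAt, ?_⟩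
  rw [show deriv (truncLog ε) = fun r => -(annulusCutoff ε r / r) from
    funext fun r => (hasDerivAt_truncLog hε r).deriv]
  exact (contDiff_annulusCutoff_div hε).neg

lemma truncLog_of_one_le {ε r : ℝ} (hr : 1 ≤ r) : truncLog ε r = 0 := by
  refine intervalIntegral.integral_zero_ae (Filter.Eventually.of_forall fun s hs => ?_)
  rw [Set.uIoc_of_ge hr] at hs
  rw [annulusCutoff_of_one_le hs.1.le, zero_div]

lemma truncLog_nonneg {ε : ℝ} (hε : 0 < ε) (r : ℝ) : 0 ≤ truncLog ε r := by
  rcases le_total r 1 with hr | hr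
  · exact intervalIntegral.integral_nonneg hr fun s _ => annulusCutoff_div_nonneg hε s
  · rw [truncLog_of_one_le hr]

lemma truncLog_of_le {ε r : ℝ} (hε : 0 < ε) (hr : r ≤ ε) : truncLog ε r = truncLog ε ε := by
  have hc := (contDiff_annulusCutoff_div hε).continuous
  rw [truncLog, truncLog, ← intervalIntegral.integral_add_adjacent_intervals
    (hc.intervalIntegrable r ε) (hc.intervalIntegrable ε 1), add_eq_right]
  refine intervalIntegral.integral_zero_ae (Filter.Eventually.of_forall fun s hs => ?_)
  rw [Set.uIoc_of_le hr] at hs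
  rw [annulusCutoff_of_le hε hs.2, zero_div]

lemma truncLog_le_neg_log {ε r : ℝ} (hε : 0 < ε) (hr : 0 < r) (hr1 : r ≤ 1) :
    truncLog ε r ≤ -Real.log r := by
  have hc := (contDiff_annulusCutoff_div hε).continuous
  have h : ∫ s in r..1, 1 / s = -Real.log r := by
    rw [integral_one_div_of_pos hr one_pos, one_div, Real.log_inv]
  rw [← h]
  refine intervalIntegral.integral_mono_on hr1 (hc.intervalIntegrable _ _)
    (intervalIntegral.intervalIntegrable_one_div (fun s hs => ?_) continuousOn_id) fun s hs => ?_
  · rw [Set.uIcc_of_le hr1] at hs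
    exact (hr.trans_le hs.1).ne'
  · exact div_le_div_of_nonneg_right (annulusCutoff_le_one _ _) (hr.le.trans hs.1)

lemma neg_log_sub_le_truncLog {ε : ℝ} (hε : 0 < ε) (hε4 : ε ≤ 1 / 4) :
    -Real.log ε - Real.log 4 ≤ truncLog ε ε := by
  have hc := (contDiff_annulusCutoff_div hε).continuous
  have h : ∫ s in (2 * ε)..(1 / 2), annulusCutoff ε s / s = -Real.log ε - Real.log 4 := by
    have h2 : (2 * ε) ≤ 1 / 2 := by linarith
    rw [← Real.log_inv, ← Real.log_div (by positivity) (by norm_num),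
      show ε⁻¹ / 4 = (1 / 2) / (2 * ε) by field_simp; norm_num,
      ← integral_one_div_of_pos (by positivity) (by norm_num)]
    refine intervalIntegral.integral_congr fun s hs => ?_
    rw [Set.uIcc_of_le h2] at hs
    simp only [annulusCutoff_eq_one hε hs.1 hs.2]
  rw [← h]
  refine intervalIntegral.integral_mono_interval (by linarith) (by linarith) (by norm_num)
    (Filter.Eventually.of_forall fun s => annulusCutoff_div_nonneg hε s)
    (hc.intervalIntegrable _ _)

lemma truncLog_eq_apply_zero {ε r : ℝ} (hε : 0 < ε) (hr : r ≤ ε) :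
    truncLog ε r = truncLog ε 0 := by
  rw [truncLog_of_le hε hr, truncLog_of_le hε hε.le]

lemma truncLog_zero_le {ε : ℝ} (hε : 0 < ε) (hε1 : ε ≤ 1) : truncLog ε 0 ≤ -Real.log ε := by
  rw [← truncLog_eq_apply_zero hε le_rfl]
  exact truncLog_le_neg_log hε hε hε1

section Radial

variable {E : Type*} [NormedAddCommGroup E] [InnerProductSpace ℝ E]

lemma contDiff_truncLog_norm {ε : ℝ} (hε : 0 < ε) :
    ContDiff ℝ (⊤ : ℕ∞) fun x : E => truncLog ε ‖x‖ := by
  rw [contDiff_iff_contDiffAt]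
  intro x
  rcases eq_or_ne x 0 with rfl | hx
  · refine (contDiffAt_const (c := truncLog ε 0)).congr_of_eventuallyEq ?_
    filter_upwards [Metric.ball_mem_nhds (0 : E) hε] with y hy
    exact truncLog_eq_apply_zero hε (mem_ball_zero_iff.1 hy).le
  · exact (contDiff_truncLog hε).contDiffAt.comp x (contDiffAt_norm ℝ hx)

lemma norm_fderiv_truncLog_norm_le {ε : ℝ} (hε : 0 < ε) (x : E) :
    ‖fderiv ℝ (fun x : E => truncLog ε ‖x‖) x‖ ≤ annulusCutoff ε ‖x‖ / ‖x‖ := by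
  rcases eq_or_ne x 0 with rfl | hx
  · have h : (fun x : E => truncLog ε ‖x‖) =ᶠ[nhds 0] fun _ => truncLog ε 0 := by
      filter_upwards [Metric.ball_mem_nhds (0 : E) hε] with y hy
      exact truncLog_eq_apply_zero hε (mem_ball_zero_iff.1 hy).le
    rw [h.fderiv_eq]
    simp
  · have hd : DifferentiableAt ℝ (fun x : E => ‖x‖) x :=
      (contDiffAt_norm ℝ hx (n := 1)).differentiableAt (by simp)
    have h : fderiv ℝ (fun x : E => truncLog ε ‖x‖) x = _ :=
      ((hasDerivAt_truncLog hε ‖x‖).comp_hasFDerivAt x hd.hasFDerivAt).fderiv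
    rw [h, norm_smul, norm_neg, Real.norm_of_nonneg (annulusCutoff_div_nonneg hε _)]
    refine mul_le_of_le_one_right (annulusCutoff_div_nonneg hε _) ?_
    simpa using norm_fderiv_le_of_lipschitz ℝ (lipschitzWith_one_norm (E := E)) (x₀ := x)

lemma hasCompactSupport_comp_norm [FiniteDimensional ℝ E] {F : Type*} [Zero F] {f : ℝ → F}
    (hf : ∀ r, 1 ≤ r → f r = 0) : HasCompactSupport fun x : E => f ‖x‖ := by
  refine HasCompactSupport.intro (isCompact_closedBall (0 : E) 1) fun x hx => hf _ ?_
  rw [mem_closedBall_zero_iff, not_le] at hx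
  exact hx.le

end Radial

lemma pow_mul_annulusCutoff_div_pow_le {ε y : ℝ} (hy : 0 < y) {n : ℕ} (hn : 1 ≤ n) :
    y ^ (n - 1) * (annulusCutoff ε y / y) ^ n ≤ annulusCutoff ε y / y := by
  obtain ⟨m, rfl⟩ := Nat.exists_eq_add_of_le' hn
  have h : y ^ (m + 1 - 1) * (annulusCutoff ε y / y) ^ (m + 1) =
      annulusCutoff ε y ^ (m + 1) / y := by
    rw [Nat.add_sub_cancel, div_pow, pow_succ y]; field_simp
  rw [h]
  refine div_le_div_of_nonneg_right ?_ hy.le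
  exact pow_le_of_le_one (annulusCutoff_nonneg _ _) (annulusCutoff_le_one _ _) (by omega)

lemma pow_mul_truncLog_pow_le {ε y : ℝ} (hε : 0 < ε) (hy : 0 < y) (hy1 : y ≤ 1) {n : ℕ}
    (hn : 2 ≤ n) : y ^ (n - 1) * truncLog ε y ^ n ≤ 2 ^ n := by
  set s := √y with hs
  have hs0 : 0 < s := Real.sqrt_pos.2 hy
  have hs1 : s ≤ 1 := Real.sqrt_le_one.2 hy1
  have hys : y = s ^ 2 := (Real.sq_sqrt hy.le).symm
  have hlog : truncLog ε y ≤ 2 / s := by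
    refine (truncLog_le_neg_log hε hy hy1).trans ?_
    have h := Real.log_le_sub_one_of_pos (inv_pos.2 hs0)
    rw [Real.log_inv] at h
    rw [hys, Real.log_pow, div_eq_mul_inv]
    push_cast
    linarith
  calc y ^ (n - 1) * truncLog ε y ^ n ≤ y ^ (n - 1) * (2 / s) ^ n := by
        gcongr
        exact truncLog_nonneg hε y
    _ = 2 ^ n * s ^ (n - 2) := by
        obtain ⟨m, rfl⟩ := Nat.exists_eq_add_of_le' hn
        rw [hys, Nat.add_sub_cancel, show m + 2 - 1 = m + 1 by omega, div_pow]
        field_simp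
        ring
    _ ≤ 2 ^ n := mul_le_of_le_one_right (by positivity) (pow_le_one₀ hs0.le hs1)

section Euclidean

variable {n : ℕ}

lemma integral_norm_fderiv_pow_add_le (hn : 2 ≤ n) {ε c : ℝ} (hε : 0 < ε) (hε1 : ε ≤ 1)
    (hc : 0 ≤ c) :
    ∫ x, (‖fderiv ℝ (fun x : EuclideanSpace ℝ (Fin n) => c * truncLog ε ‖x‖) x‖ ^ n
        + |c * truncLog ε ‖x‖| ^ n) ≤
      n * volume.real (Metric.ball (0 : EuclideanSpace ℝ (Fin n)) 1) *
        (c ^ n * (2 ^ n - Real.log ε)) := by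
  have : Nonempty (Fin n) := ⟨⟨0, by omega⟩⟩
  have hn0 : n ≠ 0 := by omega
  set H : ℝ → ℝ := fun r => c ^ n * ((annulusCutoff ε r / r) ^ n + truncLog ε r ^ n) with hH
  have hHc : Continuous H :=
    (((contDiff_annulusCutoff_div hε).continuous.pow n).add
      ((contDiff_truncLog hε).continuous.pow n)).const_mul _
  have hH1 : ∀ r, 1 ≤ r → H r = 0 := fun r hr => by
    simp [hH, annulusCutoff_of_one_le hr, truncLog_of_one_le hr, hn0]
  have hHi : Integrable fun x : EuclideanSpace ℝ (Fin n) => H ‖x‖ :=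
    (hHc.comp continuous_norm).integrable_of_hasCompactSupport (hasCompactSupport_comp_norm hH1)
  have hle : ∀ x : EuclideanSpace ℝ (Fin n),
      ‖fderiv ℝ (fun x : EuclideanSpace ℝ (Fin n) => c * truncLog ε ‖x‖) x‖ ^ n
        + |c * truncLog ε ‖x‖| ^ n ≤ H ‖x‖ := fun x => by
    rw [fderiv_const_mul ((contDiff_truncLog_norm hε).differentiable (by simp) x), norm_smul,
      Real.norm_of_nonneg hc, abs_of_nonneg (mul_nonneg hc (truncLog_nonneg hε _)), mul_pow,
      mul_pow, ← mul_add]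
    simp only [hH]
    gcongr
    exact norm_fderiv_truncLog_norm_le hε x
  refine (integral_mono_of_nonneg (Filter.Eventually.of_forall fun x => by positivity) hHi
    (Filter.Eventually.of_forall hle)).trans ?_
  rw [integral_fun_norm_addHaar, finrank_euclideanSpace_fin, nsmul_eq_mul, smul_eq_mul, ← mul_assoc]
  refine mul_le_mul_of_nonneg_left ?_ (by positivity)
  have hsub : ∫ y in Set.Ioi (0 : ℝ), y ^ (n - 1) • H y = ∫ y in (0 : ℝ)..1, y ^ (n - 1) • H y := by
    rw [intervalIntegral.integral_of_le zero_le_one]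
    refine setIntegral_eq_of_subset_of_forall_sdiff_eq_zero measurableSet_Ioi
      Set.Ioc_subset_Ioi_self fun y hy => ?_
    have hy1 : 1 ≤ y := by
      by_contra! h
      exact hy.2 ⟨hy.1, h.le⟩
    rw [hH1 y hy1, smul_zero]
  have hkc := (contDiff_annulusCutoff_div hε).continuous
  have hmono : ∫ y in (0 : ℝ)..1, y ^ (n - 1) • H y ≤
      ∫ y in (0 : ℝ)..1, c ^ n * (annulusCutoff ε y / y + 2 ^ n) := by
    refine intervalIntegral.integral_mono_on_of_le_Ioo zero_le_one
      (((continuous_pow _).smul hHc).intervalIntegrable _ _)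
      (((hkc.add continuous_const).const_mul _).intervalIntegrable _ _) fun y hy => ?_
    have h₁ := pow_mul_annulusCutoff_div_pow_le (ε := ε) hy.1 (show 1 ≤ n by omega)
    have h₂ := pow_mul_truncLog_pow_le hε hy.1 hy.2.le hn
    calc y ^ (n - 1) • H y = c ^ n * (y ^ (n - 1) * (annulusCutoff ε y / y) ^ n
          + y ^ (n - 1) * truncLog ε y ^ n) := by simp only [hH, smul_eq_mul]; ring
      _ ≤ _ := by gcongr
  rw [hsub]
  refine hmono.trans ?_
  rw [intervalIntegral.integral_const_mul, intervalIntegral.integral_add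
    (hkc.intervalIntegrable _ _) (by simp), intervalIntegral.integral_const]
  have h0 : ∫ y in (0 : ℝ)..1, annulusCutoff ε y / y ≤ -Real.log ε := truncLog_zero_le hε hε1
  refine mul_le_mul_of_nonneg_left ?_ (by positivity)
  simp only [sub_zero, one_smul]
  linarith

lemma le_integral_exp_sub_sum (hn : 2 ≤ n) {α p ε : ℝ} (hα : 0 ≤ α) (hp : 0 < p) (hε : 0 ≤ ε)
    {u : EuclideanSpace ℝ (Fin n) → ℝ} (hu : Continuous u) (hus : HasCompactSupport u) {t : ℝ}
    (ht : ∀ x ∈ Metric.ball (0 : EuclideanSpace ℝ (Fin n)) ε, α * |u x| ^ p = t) :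
    ε ^ n * volume.real (Metric.ball (0 : EuclideanSpace ℝ (Fin n)) 1) *
        (Real.exp t - ∑ j ∈ Finset.range (n - 1), t ^ j / (j.factorial : ℝ)) ≤
      ∫ x, (Real.exp (α * |u x| ^ p) -
        ∑ j ∈ Finset.range (n - 1), (α * |u x| ^ p) ^ j / (j.factorial : ℝ)) := by
  have : Nonempty (Fin n) := ⟨⟨0, by omega⟩⟩
  set Φ : ℝ → ℝ := fun t => Real.exp t - ∑ j ∈ Finset.range (n - 1), t ^ j / (j.factorial : ℝ)
    with hΦ
  have hΦc : Continuous Φ := by fun_prop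
  have hΦ0 : Φ 0 = 0 := by
    obtain ⟨m, rfl⟩ := Nat.exists_eq_add_of_le' hn
    simp [hΦ, Finset.sum_range_succ']
  have hcont : Continuous fun x => Φ (α * |u x| ^ p) :=
    hΦc.comp ((hu.abs.rpow_const fun _ => Or.inr hp.le).const_mul α)
  have hint : Integrable fun x => Φ (α * |u x| ^ p) :=
    hcont.integrable_of_hasCompactSupport <| hus.comp_left (g := fun s => Φ (α * |s| ^ p))
      (by simp [Real.zero_rpow hp.ne', hΦ0])
  have hball : ∫ x in Metric.ball (0 : EuclideanSpace ℝ (Fin n)) ε, Φ (α * |u x| ^ p) =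
      ε ^ n * volume.real (Metric.ball (0 : EuclideanSpace ℝ (Fin n)) 1) * Φ t := by
    rw [setIntegral_congr_fun (g := fun _ => Φ t) Metric.isOpen_ball.measurableSet
      fun x hx => by simp only [ht x hx], setIntegral_const, smul_eq_mul, measureReal_def,
      Measure.addHaar_ball volume 0 hε, ENNReal.toReal_mul,
      ENNReal.toReal_ofReal (by positivity), finrank_euclideanSpace_fin, measureReal_def]
  rw [← hball]
  refine setIntegral_le_integral hint (Filter.Eventually.of_forall fun x => ?_)
  exact sub_nonneg.2 (Real.sum_le_exp_of_nonneg (by positivity) _)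

end Euclidean

lemma eventually_exp_div_two_le (m : ℕ) : ∀ᶠ t : ℝ in Filter.atTop,
    Real.exp t / 2 ≤ Real.exp t - ∑ j ∈ Finset.range m, t ^ j / (j.factorial : ℝ) := by
  have h : (∑ j ∈ Finset.range m, fun t : ℝ => t ^ j / (j.factorial : ℝ))
      =o[Filter.atTop] fun t : ℝ => Real.exp t := by
    refine Asymptotics.IsLittleO.sum fun j _ => ?_
    simp only [div_eq_inv_mul]
    refine Asymptotics.IsLittleO.const_mul_left ?_ _
    simpa using isLittleO_pow_exp_pos_mul_atTop j one_pos
  filter_upwards [h.bound (show (0 : ℝ) < 1 / 2 by norm_num)] with t ht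
  rw [Finset.sum_apply, Real.norm_eq_abs, Real.norm_eq_abs, Real.abs_exp] at ht
  linarith [le_abs_self (∑ j ∈ Finset.range m, t ^ j / (j.factorial : ℝ))]

lemma eventually_mul_pow_mul_le_sub_pow {n : ℕ} (hn : 1 ≤ n) (a b : ℝ) {κ : ℝ} (hκ : κ < 1) :
    ∀ᶠ L : ℝ in Filter.atTop, κ * L ^ (n - 1) * (b + L) ≤ (L - a) ^ n := by
  have h₁ : Filter.Tendsto (fun L : ℝ => κ * (1 + b / L)) Filter.atTop (nhds (κ * (1 + 0))) :=
    (tendsto_const_nhds.add (tendsto_const_nhds.div_atTop Filter.tendsto_id)).const_mul _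
  have h₂ : Filter.Tendsto (fun L : ℝ => (1 - a / L) ^ n) Filter.atTop (nhds ((1 - 0) ^ n)) :=
    (tendsto_const_nhds.sub (tendsto_const_nhds.div_atTop Filter.tendsto_id)).pow _
  filter_upwards [h₁.eventually_lt h₂ (by simpa using hκ), Filter.eventually_gt_atTop 0]
    with L hL hL0
  obtain ⟨m, rfl⟩ := Nat.exists_eq_add_of_le' hn
  calc κ * L ^ (m + 1 - 1) * (b + L) = κ * (1 + b / L) * L ^ (m + 1) := by
        rw [Nat.add_sub_cancel]; field_simp; ring
    _ ≤ (1 - a / L) ^ (m + 1) * L ^ (m + 1) := by gcongr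
    _ = (L - a) ^ (m + 1) := by rw [← mul_pow]; congr 1; field_simp

lemma exists_ratio {n : ℕ} (hn : 2 ≤ n) {A α : ℝ} (hA : 0 < A)
    (hα : n * A ^ ((1 : ℝ) / ((n : ℝ) - 1)) < α) :
    ∃ q : ℝ, 0 < q ∧ n < α * q ∧ q ^ (n - 1) * A < 1 := by
  have hn1 : (1 : ℝ) < n := by exact_mod_cast hn
  set B := A ^ ((1 : ℝ) / ((n : ℝ) - 1)) with hB
  have hB0 : 0 < B := Real.rpow_pos_of_pos hA _
  have hBA : B ^ (n - 1) = A := by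
    rw [hB, ← Real.rpow_natCast, ← Real.rpow_mul hA.le, Nat.cast_sub (by omega), Nat.cast_one,
      one_div_mul_cancel (by linarith), Real.rpow_one]
  have hα0 : 0 < α := lt_of_le_of_lt (by positivity) hα
  obtain ⟨q, hq₁, hq₂⟩ := exists_between (show n / α < 1 / B by
    rw [div_lt_div_iff₀ hα0 hB0]; linarith)
  have hq0 : 0 < q := lt_trans (by positivity) hq₁
  refine ⟨q, hq0, ?_, ?_⟩
  · rw [div_lt_iff₀ hα0] at hq₁; linarith
  · rw [← hBA, ← mul_pow]
    rw [lt_div_iff₀ hB0] at hq₂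
    exact pow_lt_one₀ (by positivity) hq₂ (by omega)

lemma exists_moser_parameters {n : ℕ} (hn : 2 ≤ n) {A α : ℝ} (hA : 0 < A)
    (hα : n * A ^ ((1 : ℝ) / ((n : ℝ) - 1)) < α) (M : ℝ) {v : ℝ} (hv : 0 < v) :
    ∃ ε c : ℝ, 0 < ε ∧ ε ≤ 1 / 4 ∧ 0 ≤ c ∧ A * (c ^ n * (2 ^ n - Real.log ε)) ≤ 1 ∧
      ∀ w, -Real.log ε - Real.log 4 ≤ w →
        M ≤ ε ^ n * v * (Real.exp (α * (c * w) ^ ((n : ℝ) / ((n : ℝ) - 1))) -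
          ∑ j ∈ Finset.range (n - 1),
            (α * (c * w) ^ ((n : ℝ) / ((n : ℝ) - 1))) ^ j / (j.factorial : ℝ)) := by
  have hn1 : (1 : ℝ) < n := by exact_mod_cast hn
  have hn0 : n ≠ 0 := by omega
  obtain ⟨q, hq, hαq, hqA⟩ := exists_ratio hn hA hα
  have hα0 : 0 < α := lt_of_le_of_lt (by positivity) hα
  obtain ⟨T, hT⟩ := Filter.eventually_atTop.1 (eventually_exp_div_two_le (n - 1))
  have hexp : Filter.Tendsto (fun L : ℝ => v / 2 * Real.exp ((α * q - n) * L)) Filter.atTop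
      Filter.atTop :=
    (Real.tendsto_exp_atTop.comp
      (Filter.tendsto_id.const_mul_atTop (by linarith))).const_mul_atTop (by positivity)
  have hlin : Filter.Tendsto (fun L : ℝ => α * q * L) Filter.atTop Filter.atTop :=
    Filter.tendsto_id.const_mul_atTop (by positivity)
  obtain ⟨L, hL₁, hL₂, hL₃, hL₄⟩ := ((eventually_mul_pow_mul_le_sub_pow (show 1 ≤ n by omega)
    (Real.log 4) (2 ^ n) hqA).and ((Filter.eventually_ge_atTop (Real.log 4)).and
      ((hexp.eventually_ge_atTop M).and (hlin.eventually_ge_atTop T)))).exists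
  have hL0 : 0 < L := (Real.log_pos (by norm_num)).trans_le hL₂
  have hD : 0 < A * (2 ^ n + L) := by positivity
  set c := (A * (2 ^ n + L))⁻¹ ^ ((n : ℝ)⁻¹) with hc
  have hc0 : 0 < c := by positivity
  have hcn : c ^ n = (A * (2 ^ n + L))⁻¹ := Real.rpow_inv_natCast_pow (by positivity) hn0
  refine ⟨Real.exp (-L), c, Real.exp_pos _, ?_, hc0.le, ?_, fun w hw => ?_⟩
  · rw [Real.exp_neg, one_div]
    refine inv_anti₀ (by norm_num) ?_
    rwa [← Real.log_le_iff_le_exp (by norm_num)]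
  · rw [hcn, Real.log_exp]
    apply le_of_eq
    field_simp
    ring
  rw [Real.log_exp, neg_neg] at hw
  have hw0 : 0 ≤ w := by linarith
  have hpow : (q * L) ^ (n - 1) ≤ (c * w) ^ n := by
    rw [mul_pow c, hcn, inv_mul_eq_div, le_div_iff₀ hD]
    calc (q * L) ^ (n - 1) * (A * (2 ^ n + L)) = q ^ (n - 1) * A * L ^ (n - 1) * (2 ^ n + L) := by
          ring
      _ ≤ (L - Real.log 4) ^ n := hL₁
      _ ≤ w ^ n := by gcongr
  have hqL : q * L ≤ (c * w) ^ ((n : ℝ) / ((n : ℝ) - 1)) := by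
    rw [div_eq_mul_inv, Real.rpow_mul (by positivity), Real.rpow_natCast,
      Real.le_rpow_inv_iff_of_pos (by positivity) (by positivity) (by linarith)]
    have h : (n : ℝ) - 1 = ((n - 1 : ℕ) : ℝ) := by
      rw [Nat.cast_sub (by omega), Nat.cast_one]
    rwa [h, Real.rpow_natCast]
  set t := α * (c * w) ^ ((n : ℝ) / ((n : ℝ) - 1)) with ht
  have htL : α * q * L ≤ t := by
    rw [ht, mul_assoc]
    gcongr
  calc M ≤ v / 2 * Real.exp ((α * q - n) * L) := hL₃
    _ = Real.exp (-L) ^ n * v * (Real.exp (α * q * L) / 2) := by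
        rw [← Real.exp_nat_mul, show (α * q - n) * L = n * -L + α * q * L by ring, Real.exp_add]
        ring
    _ ≤ Real.exp (-L) ^ n * v * (Real.exp t / 2) := by gcongr
    _ ≤ _ := by
        gcongr
        exact hT t (hL₄.trans htL)

theorem stmt_16 (n : ℕ) (hn : 2 ≤ n) (α : ℝ)
    (hα : n * (n * (volume (Metric.ball (0 : EuclideanSpace ℝ (Fin n)) 1)).toReal) ^
      ((1 : ℝ) / ((n : ℝ) - 1)) < α) :
    ∀ M : ℝ, ∃ u : EuclideanSpace ℝ (Fin n) → ℝ,
      ContDiff ℝ (⊤ : ℕ∞) u ∧ HasCompactSupport u ∧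
      (∫ x, (‖fderiv ℝ u x‖ ^ n + |u x| ^ n)) ≤ 1 ∧
      M ≤ ∫ x, (Real.exp (α * |u x| ^ ((n : ℝ) / ((n : ℝ) - 1))) -
        ∑ j ∈ Finset.range (n - 1),
          (α * |u x| ^ ((n : ℝ) / ((n : ℝ) - 1))) ^ j / (j.factorial : ℝ)) := by
  intro M
  have hn1 : (1 : ℝ) < n := by exact_mod_cast hn
  have hv : 0 < volume.real (Metric.ball (0 : EuclideanSpace ℝ (Fin n)) 1) :=
    ENNReal.toReal_pos (Metric.measure_ball_pos volume _ one_pos).ne' measure_ball_lt_top.ne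
  have hα0 : 0 < α := lt_of_le_of_lt (by positivity) hα
  obtain ⟨ε, c, hε, hε4, hc, hle, hM⟩ :=
    exists_moser_parameters hn (by positivity) hα M hv
  have hsmooth : ContDiff ℝ (⊤ : ℕ∞)
      fun x : EuclideanSpace ℝ (Fin n) => c * truncLog ε ‖x‖ :=
    contDiff_const.mul (contDiff_truncLog_norm hε)
  have hsupp : HasCompactSupport fun x : EuclideanSpace ℝ (Fin n) => c * truncLog ε ‖x‖ :=
    hasCompactSupport_comp_norm (f := fun r => c * truncLog ε r) fun r hr => by
      rw [truncLog_of_one_le hr, mul_zero]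
  refine ⟨fun x => c * truncLog ε ‖x‖, hsmooth, hsupp,
    (integral_norm_fderiv_pow_add_le hn hε (by linarith) hc).trans hle,
    (hM _ (neg_log_sub_le_truncLog hε hε4)).trans ?_⟩
  refine le_integral_exp_sub_sum hn hα0.le (div_pos (by linarith) (by linarith)) hε.le
    hsmooth.continuous hsupp fun x hx => ?_
  rw [truncLog_of_le hε (mem_ball_zero_iff.1 hx).le,
    abs_of_nonneg (mul_nonneg hc (truncLog_nonneg hε _))]
end

section
/- Let n ≥ 2 and α_n = n·ω_{n-1}^{1/(n-1)}. There exists a constant d > 0 such that for every open set Ω ⊆ ℝ^n and every u ∈ H^{1,n}_0(Ω) with ∫_Ω (|∇u|^n + |u|^n) dx ≤ 1, one has ∫_Ω Φ(α_n·|u|^{n/(n-1)}) dx ≤ d, where Φ(t) = e^t - ∑_{j=0}^{n-2} t^j/j!. -/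
open MeasureTheory

section

open scoped ENNReal

theorem Real.volume_add_le_of_add_subset {A B C : Set ℝ} (hA : MeasurableSet A)
    (hB : MeasurableSet B) (hA0 : A.Nonempty) (hB0 : B.Nonempty)
    (h : ∀ a ∈ A, ∀ b ∈ B, a + b ∈ C) : volume A + volume B ≤ volume C := by
  obtain ⟨a₀, ha₀⟩ := hA0
  obtain ⟨b₀, hb₀⟩ := hB0
  have hBC : volume B ≤ volume C := by
    rw [← measure_preimage_add volume (-a₀) B]
    refine measure_mono fun x hx => ?_
    simpa using h a₀ ha₀ _ hx
  have hAC : volume A ≤ volume C := by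
    rw [← measure_preimage_add volume (-b₀) A]
    refine measure_mono fun x hx => ?_
    have := h _ hx b₀ hb₀
    simpa using this
  have key : ∀ r < volume A, ∀ q < volume B, r + q ≤ volume C := by
    intro r hr q hq
    obtain ⟨K, hKA, hK, hrK⟩ := hA.exists_lt_isCompact hr
    obtain ⟨L, hLB, hL, hqL⟩ := hB.exists_lt_isCompact hq
    have hK0 : K.Nonempty := nonempty_of_measure_ne_zero (bot_lt_of_lt hrK).ne'
    have hL0 : L.Nonempty := nonempty_of_measure_ne_zero (bot_lt_of_lt hqL).ne'
    obtain ⟨M, hMK, hM⟩ := hK.exists_isGreatest hK0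
    obtain ⟨m, hmL, hm⟩ := hL.exists_isLeast hL0
    have e1 : volume ((fun x => -m + x) ⁻¹' K) = volume K := measure_preimage_add volume (-m) K
    have e2 : volume ((fun x => -M + x) ⁻¹' L) = volume L := measure_preimage_add volume (-M) L
    have hdisj : AEDisjoint volume ((fun x => -m + x) ⁻¹' K) ((fun x => -M + x) ⁻¹' L) := by
      refine measure_mono_null (t := {M + m}) ?_ (by simp)
      rintro x ⟨h1, h2⟩
      have := hM h1
      have := hm h2
      simp only [Set.mem_singleton_iff]
      linarith
    calc r + q ≤ volume K + volume L := add_le_add hrK.le hqL.le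
      _ = volume ((fun x => -m + x) ⁻¹' K ∪ (fun x => -M + x) ⁻¹' L) := by
          rw [measure_union₀ _ hdisj, e1, e2]
          exact ((hL.measurableSet).preimage (by fun_prop)).nullMeasurableSet
      _ ≤ volume C := by
          refine measure_mono ?_
          rintro x (hx | hx)
          · have := h _ (hKA hx) m (hLB hmL)
            simpa using this
          · have := h M (hKA hMK) _ (hLB hx)
            simpa using this
  rcases eq_or_ne (volume A) 0 with h0 | h0
  · simpa [h0] using hBC
  rcases eq_or_ne (volume B) 0 with h0' | h0'
  · simpa [h0'] using hAC
  refine le_of_forall_lt fun c hc => ?_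
  by_contra hcon
  push Not at hcon
  obtain ⟨r, hr, q, hq, hrq⟩ := ENNReal.exists_lt_add_of_lt_add hc h0 h0'
  exact absurd (hrq.trans_le (key _ hr _ hq)) (not_lt.2 hcon)

theorem Real.smul_volume_add_le_of_subset {A B C : Set ℝ} {s t : ℝ} (hs : 0 < s) (ht : 0 < t)
    (hA : MeasurableSet A) (hB : MeasurableSet B) (hA0 : A.Nonempty) (hB0 : B.Nonempty)
    (h : ∀ a ∈ A, ∀ b ∈ B, s * a + t * b ∈ C) :
    ENNReal.ofReal s * volume A + ENNReal.ofReal t * volume B ≤ volume C := by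
  have e : ∀ {r : ℝ}, 0 < r → ∀ D : Set ℝ,
      ENNReal.ofReal r * volume D = volume ((fun x => r⁻¹ * x) ⁻¹' D) := by
    intro r hr D
    rw [Real.volume_preimage_mul_left (inv_pos.2 hr).ne']
    simp [abs_of_pos hr]
  rw [e hs, e ht]
  refine Real.volume_add_le_of_add_subset (hA.preimage (by fun_prop)) (hB.preimage (by fun_prop))
    ?_ ?_ ?_
  · obtain ⟨a, ha⟩ := hA0
    exact ⟨s * a, by simpa [hs.ne'] using ha⟩
  · obtain ⟨a, ha⟩ := hB0
    exact ⟨t * a, by simpa [ht.ne'] using ha⟩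
  · intro a ha b hb
    have := h _ ha _ hb
    simpa [hs.ne', ht.ne'] using this

theorem Real.lintegral_add_le_of_min_le {s t : ℝ} (hs : 0 < s) (ht : 0 < t)
    {f g h : ℝ → ℝ} (hf : Measurable f) (hg : Measurable g) (hh : Measurable h)
    (f0 : ∀ x, 0 ≤ f x) (g0 : ∀ x, 0 ≤ g x) (h0 : ∀ x, 0 ≤ h x)
    (f1 : ∀ x, f x ≤ 1) (g1 : ∀ x, g x ≤ 1)
    (fs : ∀ τ < 1, ∃ x, τ < f x) (gs : ∀ τ < 1, ∃ x, τ < g x)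
    (H : ∀ x y, min (f x) (g y) ≤ h (s * x + t * y)) :
    ENNReal.ofReal s * (∫⁻ x, ENNReal.ofReal (f x)) + ENNReal.ofReal t *
      (∫⁻ x, ENNReal.ofReal (g x)) ≤ ∫⁻ x, ENNReal.ofReal (h x) := by
  rw [lintegral_eq_lintegral_meas_lt volume (Filter.Eventually.of_forall f0) hf.aemeasurable,
    lintegral_eq_lintegral_meas_lt volume (Filter.Eventually.of_forall g0) hg.aemeasurable,
    lintegral_eq_lintegral_meas_le volume (Filter.Eventually.of_forall h0) hh.aemeasurable]
  have anti : ∀ k : ℝ → ℝ, Measurable fun τ : ℝ => volume {x | τ < k x} := fun k =>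
    Antitone.measurable fun a b hab => measure_mono fun x hx => lt_of_le_of_lt hab hx
  rw [← lintegral_const_mul _ (anti f), ← lintegral_const_mul _ (anti g),
    ← lintegral_add_left ((anti f).const_mul _)]
  refine setLIntegral_mono' measurableSet_Ioi fun τ _ => ?_
  rcases lt_or_ge τ 1 with h1 | h1
  · refine Real.smul_volume_add_le_of_subset hs ht (measurableSet_lt measurable_const hf)
      (measurableSet_lt measurable_const hg) (fs τ h1) (gs τ h1) fun a ha b hb => ?_
    exact (lt_min ha hb).le.trans (H a b)
  · have e1 : {x | τ < f x} = ∅ := Set.eq_empty_of_forall_notMem fun x hx =>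
      absurd (f1 x) (not_le.2 (lt_of_le_of_lt h1 hx))
    have e2 : {x | τ < g x} = ∅ := Set.eq_empty_of_forall_notMem fun x hx =>
      absurd (g1 x) (not_le.2 (lt_of_le_of_lt h1 hx))
    simp [e1, e2]

theorem ENNReal.min_le_rpow_mul_rpow {a b : ℝ≥0∞} {s t : ℝ} (hs : 0 < s) (ht : 0 < t)
    (hst : s + t = 1) : min a b ≤ a ^ s * b ^ t := by
  calc min a b = min a b ^ s * min a b ^ t := by
        rw [← ENNReal.rpow_add_of_nonneg _ _ hs.le ht.le, hst, ENNReal.rpow_one]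
    _ ≤ a ^ s * b ^ t := by gcongr <;> simp

theorem ENNReal.rpow_mul_rpow_le_add {a b : ℝ≥0∞} {s t : ℝ} (hs : 0 < s) (ht : 0 < t)
    (hst : s + t = 1) : a ^ s * b ^ t ≤ ENNReal.ofReal s * a + ENNReal.ofReal t * b := by
  induction a with
  | top => simp [ENNReal.mul_top, hs]
  | coe a =>
    induction b with
    | top => simp [ENNReal.mul_top, ht]
    | coe b =>
      have := NNReal.geom_mean_le_arith_mean2_weighted s.toNNReal t.toNNReal a b
        (by rw [← Real.toNNReal_add hs.le ht.le, hst, Real.toNNReal_one])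
      rw [Real.coe_toNNReal _ hs.le, Real.coe_toNNReal _ ht.le] at this
      rw [← ENNReal.coe_rpow_of_nonneg _ hs.le, ← ENNReal.coe_rpow_of_nonneg _ ht.le]
      unfold ENNReal.ofReal
      exact_mod_cast this

theorem lintegral_add_le_of_iSup_eq_one {s t : ℝ} (hs : 0 < s) (ht : 0 < t) (hst : s + t = 1)
    {f g h : ℝ → ℝ≥0∞} (hf : Measurable f) (hg : Measurable g) (hh : Measurable h)
    (f1 : ⨆ x, f x = 1) (g1 : ⨆ x, g x = 1)
    (H : ∀ x y, f x ^ s * g y ^ t ≤ h (s * x + t * y)) :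
    ENNReal.ofReal s * (∫⁻ x, f x) + ENNReal.ofReal t * (∫⁻ x, g x) ≤ ∫⁻ x, h x := by
  have fle : ∀ x, f x ≤ 1 := fun x => f1 ▸ le_iSup f x
  have gle : ∀ x, g x ≤ 1 := fun x => g1 ▸ le_iSup g x
  have aux : ∀ k : ℝ → ℝ≥0∞, (∀ x, k x ≤ 1) → ∀ x, ENNReal.ofReal (k x).toReal = k x :=
    fun k hk x => ENNReal.ofReal_toReal ((hk x).trans_lt ENNReal.one_lt_top).ne
  have aux1 : ∀ k : ℝ → ℝ≥0∞, (∀ x, k x ≤ 1) → ∀ x, (k x).toReal ≤ 1 :=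
    fun k hk x => ENNReal.toReal_le_of_le_ofReal zero_le_one (by simpa using hk x)
  have auxs : ∀ k : ℝ → ℝ≥0∞, (∀ x, k x ≤ 1) → (⨆ x, k x = 1) → ∀ τ : ℝ, τ < 1 →
      ∃ x, τ < (k x).toReal := by
    intro k hk hs τ hτ
    have : ENNReal.ofReal τ < ⨆ x, k x := by
      rw [hs]; exact ENNReal.ofReal_lt_one.2 hτ
    obtain ⟨x, hx⟩ := lt_iSup_iff.1 this
    rw [← aux k hk x] at hx
    exact ⟨x, (ENNReal.ofReal_lt_ofReal_iff').1 hx |>.1⟩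
  have := Real.lintegral_add_le_of_min_le hs ht (f := fun x => (f x).toReal)
    (g := fun x => (g x).toReal) (h := fun x => (min (h x) 1).toReal)
    hf.ennreal_toReal hg.ennreal_toReal (hh.min measurable_const).ennreal_toReal
    (fun _ => ENNReal.toReal_nonneg) (fun _ => ENNReal.toReal_nonneg)
    (fun _ => ENNReal.toReal_nonneg) (aux1 f fle) (aux1 g gle)
    (auxs f fle f1) (auxs g gle g1) ?_
  · simp only [aux f fle, aux g gle, aux _ fun x => min_le_right (h x) 1] at this
    exact this.trans (lintegral_mono fun x => min_le_left _ _)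
  · intro x y
    have hfx := ((fle x).trans_lt ENNReal.one_lt_top).ne
    have hgy := ((gle y).trans_lt ENNReal.one_lt_top).ne
    rw [← ENNReal.toReal_min hfx hgy]
    refine ENNReal.toReal_mono ((min_le_right _ _).trans_lt ENNReal.one_lt_top).ne ?_
    refine le_min ((ENNReal.min_le_rpow_mul_rpow hs ht hst).trans (H x y)) ?_
    exact (min_le_left _ _).trans (fle x)

/-- The Prékopa–Leindler inequality, as a property of a measure on a real vector space. -/
def PrekopaLeindler {E : Type*} [AddCommGroup E] [Module ℝ E] [MeasurableSpace E]
    (μ : Measure E) : Prop :=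
  ∀ ⦃s t : ℝ⦄, 0 < s → 0 < t → s + t = 1 → ∀ ⦃f g h : E → ℝ≥0∞⦄, Measurable f → Measurable g →
    Measurable h → (∀ x y, f x ^ s * g y ^ t ≤ h (s • x + t • y)) →
    (∫⁻ x, f x ∂μ) ^ s * (∫⁻ x, g x ∂μ) ^ t ≤ ∫⁻ x, h x ∂μ

theorem prekopaLeindler_real : PrekopaLeindler (volume : Measure ℝ) := by
  intro s t hs ht hst f g h hf hg hh H
  rcases eq_or_ne (∫⁻ x, f x) 0 with f0 | f0
  · simp [f0, hs]
  rcases eq_or_ne (∫⁻ x, g x) 0 with g0 | g0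
  · simp [g0, ht]
  have bdd : ∀ f g : ℝ → ℝ≥0∞, Measurable f → Measurable g →
      (∀ x y, f x ^ s * g y ^ t ≤ h (s • x + t • y)) → (⨆ x, f x) ≠ ∞ → (⨆ x, g x) ≠ ∞ →
      (∫⁻ x, f x) ^ s * (∫⁻ x, g x) ^ t ≤ ∫⁻ x, h x := by
    intro f g hf hg H hfb hgb
    rcases eq_or_ne (⨆ x, f x) 0 with f0 | f0
    · simp only [ENNReal.iSup_eq_zero] at f0
      simp [f0, hs]
    rcases eq_or_ne (⨆ x, g x) 0 with g0 | g0
    · simp only [ENNReal.iSup_eq_zero] at g0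
      simp [g0, ht]
    set a := ⨆ x, f x
    set b := ⨆ x, g x
    have hai : a⁻¹ ≠ ∞ := ENNReal.inv_ne_top.2 f0
    have hbi : b⁻¹ ≠ ∞ := ENNReal.inv_ne_top.2 g0
    have key := lintegral_add_le_of_iSup_eq_one hs ht hst (f := fun x => a⁻¹ * f x)
      (g := fun x => b⁻¹ * g x) (h := fun x => (a⁻¹ ^ s * b⁻¹ ^ t) * h x)
      (hf.const_mul _) (hg.const_mul _) (hh.const_mul _)
      (by rw [← ENNReal.mul_iSup]; exact ENNReal.inv_mul_cancel f0 hfb)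
      (by rw [← ENNReal.mul_iSup]; exact ENNReal.inv_mul_cancel g0 hgb)
      (fun x y => by
        rw [ENNReal.mul_rpow_of_nonneg _ _ hs.le, ENNReal.mul_rpow_of_nonneg _ _ ht.le,
          mul_mul_mul_comm]
        gcongr
        exact H x y)
    have key2 := (ENNReal.rpow_mul_rpow_le_add hs ht hst).trans key
    rw [lintegral_const_mul _ hf, lintegral_const_mul _ hg, lintegral_const_mul _ hh,
      ENNReal.mul_rpow_of_nonneg _ _ hs.le, ENNReal.mul_rpow_of_nonneg _ _ ht.le,
      mul_mul_mul_comm] at key2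
    refine (ENNReal.mul_le_mul_iff_right ?_ ?_).1 key2
    · refine mul_ne_zero ?_ ?_
      · simp [hs, hfb, ENNReal.rpow_eq_zero_iff, hai]
      · simp [ht, hgb, ENNReal.rpow_eq_zero_iff, hbi]
    · exact ENNReal.mul_ne_top (ENNReal.rpow_ne_top_of_nonneg hs.le hai)
        (ENNReal.rpow_ne_top_of_nonneg ht.le hbi)
  have trunc : ∀ k : ℝ → ℝ≥0∞, Measurable k → Filter.Tendsto
      (fun N : ℕ => ∫⁻ x, min (k x) N) Filter.atTop (nhds (∫⁻ x, k x)) := by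
    intro k hk
    refine lintegral_tendsto_of_tendsto_of_monotone
      (fun N => (hk.min measurable_const).aemeasurable) (Filter.Eventually.of_forall ?_)
      (Filter.Eventually.of_forall ?_)
    · intro x N M hNM
      dsimp only
      gcongr
    · intro x
      have : Filter.Tendsto (fun N : ℕ => min (k x) (N : ℝ≥0∞)) Filter.atTop
          (nhds (min (k x) ∞)) := tendsto_const_nhds.min ENNReal.tendsto_nat_nhds_top
      simpa using this
  have lim := ENNReal.Tendsto.mul
    ((ENNReal.continuous_rpow_const (y := s)).tendsto _ |>.comp (trunc f hf)) (by simp [f0, hs.le, hs])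
    ((ENNReal.continuous_rpow_const (y := t)).tendsto _ |>.comp (trunc g hg)) (by simp [g0, ht.le, ht])
  refine le_of_tendsto' lim fun N => ?_
  refine bdd _ _ (hf.min measurable_const) (hg.min measurable_const) (fun x y => ?_) ?_ ?_
  · refine le_trans ?_ (H x y)
    gcongr <;> simp
  · exact ((iSup_le fun x => min_le_right _ _).trans_lt (ENNReal.natCast_lt_top N)).ne
  · exact ((iSup_le fun x => min_le_right _ _).trans_lt (ENNReal.natCast_lt_top N)).ne

theorem PrekopaLeindler.prod {E F : Type*} [AddCommGroup E] [Module ℝ E] [MeasurableSpace E]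
    [AddCommGroup F] [Module ℝ F] [MeasurableSpace F] {μ : Measure E} {ν : Measure F}
    [SFinite μ] [SFinite ν] (hμ : PrekopaLeindler μ) (hν : PrekopaLeindler ν) :
    PrekopaLeindler (μ.prod ν) := by
  intro s t hs ht hst f g h hf hg hh H
  rw [lintegral_prod _ hf.aemeasurable, lintegral_prod _ hg.aemeasurable,
    lintegral_prod _ hh.aemeasurable]
  refine hμ hs ht hst hf.lintegral_prod_right' hg.lintegral_prod_right' hh.lintegral_prod_right'
    fun x y => ?_
  exact hν hs ht hst (hf.comp measurable_prodMk_left) (hg.comp measurable_prodMk_left)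
    (hh.comp measurable_prodMk_left) fun x' y' => H (x, x') (y, y')

theorem PrekopaLeindler.of_measurePreserving {E F : Type*} [AddCommGroup E] [Module ℝ E]
    [MeasurableSpace E] [AddCommGroup F] [Module ℝ F] [MeasurableSpace F] {μ : Measure E}
    {ν : Measure F} (hμ : PrekopaLeindler μ) (e : E → F) (he : MeasurePreserving e μ ν)
    (hadd : ∀ x y, e (x + y) = e x + e y) (hsmul : ∀ (c : ℝ) x, e (c • x) = c • e x) :
    PrekopaLeindler ν := by
  intro s t hs ht hst f g h hf hg hh H
  rw [← he.lintegral_comp hf, ← he.lintegral_comp hg, ← he.lintegral_comp hh]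
  refine hμ hs ht hst (hf.comp he.measurable) (hg.comp he.measurable) (hh.comp he.measurable)
    fun x y => ?_
  rw [hadd, hsmul, hsmul]
  exact H _ _

theorem prekopaLeindler_pi (n : ℕ) : PrekopaLeindler (volume : Measure (Fin n → ℝ)) := by
  induction n with
  | zero =>
    intro s t hs ht hst f g h hf hg hh H
    rw [Measure.volume_pi_eq_dirac 0, lintegral_dirac, lintegral_dirac, lintegral_dirac]
    exact (H 0 0).trans_eq (by congr 1; exact Subsingleton.elim _ _)
  | succ n ih =>
    refine (prekopaLeindler_real.prod ih).of_measurePreserving _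
      (volume_preserving_piFinSuccAbove (fun _ : Fin (n + 1) => ℝ) 0).symm ?_ ?_
    · intro x y
      ext i
      refine Fin.cases ?_ (fun j => ?_) i <;> simp [MeasurableEquiv.piFinSuccAbove]
    · intro c x
      ext i
      refine Fin.cases ?_ (fun j => ?_) i <;> simp [MeasurableEquiv.piFinSuccAbove]

theorem prekopaLeindler_euclideanSpace (n : ℕ) :
    PrekopaLeindler (volume : Measure (EuclideanSpace ℝ (Fin n))) :=
  (prekopaLeindler_pi n).of_measurePreserving _ (PiLp.volume_preserving_toLp (Fin n))
    (fun _ _ => rfl) (fun _ _ => rfl)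

theorem pow_add_mul_pow_le_add_pow {a x : ℝ} (ha : 0 ≤ a) (hx : 0 ≤ x) (m : ℕ) :
    a ^ (m + 1) + (m + 1) * a ^ m * x ≤ (a + x) ^ (m + 1) := by
  induction m with
  | zero => simp
  | succ m ih =>
    have h1 : 0 ≤ (m + 1) * a ^ m * x * x := by positivity
    calc a ^ (m + 1 + 1) + ((m + 1 : ℕ) + 1) * a ^ (m + 1) * x
        ≤ (a ^ (m + 1) + (m + 1) * a ^ m * x) * (a + x) := by
          push_cast
          ring_nf at h1 ⊢
          linarith
      _ ≤ (a + x) ^ (m + 1) * (a + x) := by gcongr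
      _ = (a + x) ^ (m + 1 + 1) := by ring

/-- The Brunn–Minkowski inequality for the sum of a set with a Euclidean ball. -/
theorem brunnMinkowski_ball {n : ℕ} {K W : Set (EuclideanSpace ℝ (Fin n))}
    (hK : MeasurableSet K) (hW : MeasurableSet W) {ε κ B : ℝ} (hε : 0 < ε) (hκ : 0 < κ)
    (hB : 0 < B) (hBn : ENNReal.ofReal (B ^ n) = volume (Metric.ball (0 : EuclideanSpace ℝ (Fin n)) 1))
    (hκn : ENNReal.ofReal (κ ^ n) = volume K)
    (hKW : ∀ x ∈ K, ∀ y, dist y x ≤ ε → y ∈ W) :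
    ENNReal.ofReal ((κ + ε * B) ^ n) ≤ volume W := by
  set D := κ + ε * B with hD
  have hD0 : 0 < D := by positivity
  have hs : 0 < κ / D := by positivity
  have ht : 0 < ε * B / D := by positivity
  have hst : κ / D + ε * B / D = 1 := by rw [← add_div, ← hD, div_self hD0.ne']
  set s := κ / D
  set t := ε * B / D
  have hA1 : volume ((fun x => s • x) ⁻¹' K) = ENNReal.ofReal (D ^ n) := by
    rw [Measure.addHaar_preimage_smul _ hs.ne', ← hκn, ← ENNReal.ofReal_mul (abs_nonneg _)]
    congr 1
    rw [finrank_euclideanSpace_fin, abs_of_pos (by positivity)]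
    simp only [s, div_pow]
    field_simp
  have hA2 : volume ((fun x => t • x) ⁻¹' Metric.ball (0 : EuclideanSpace ℝ (Fin n)) ε)
      = ENNReal.ofReal (D ^ n) := by
    rw [Measure.addHaar_preimage_smul _ ht.ne', Measure.addHaar_ball_of_pos _ _ hε, ← hBn,
      ← ENNReal.ofReal_mul (by positivity), ← ENNReal.ofReal_mul (abs_nonneg _)]
    congr 1
    rw [finrank_euclideanSpace_fin, abs_of_pos (by positivity)]
    simp only [t, div_pow, mul_pow]
    field_simp
  have m1 : MeasurableSet ((fun x => s • x) ⁻¹' K) := hK.preimage (by fun_prop)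
  have m2 : MeasurableSet ((fun x => t • x) ⁻¹' Metric.ball (0 : EuclideanSpace ℝ (Fin n)) ε) :=
    measurableSet_ball.preimage (by fun_prop)
  have key := prekopaLeindler_euclideanSpace n hs ht hst
    (measurable_one.indicator m1) (measurable_one.indicator m2) (measurable_one.indicator hW) (by
      intro x y
      by_cases hx : x ∈ (fun x => s • x) ⁻¹' K
      · by_cases hy : y ∈ (fun x => t • x) ⁻¹' Metric.ball (0 : EuclideanSpace ℝ (Fin n)) ε
        · have : s • x + t • y ∈ W := by
            refine hKW _ hx _ ?_
            have hy' : t • y ∈ Metric.ball (0 : EuclideanSpace ℝ (Fin n)) ε := hy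
            rw [mem_ball_zero_iff] at hy'
            rw [dist_eq_norm, add_sub_cancel_left]
            exact hy'.le
          simp [Set.indicator_of_mem hx, Set.indicator_of_mem hy, Set.indicator_of_mem this]
        · simp [Set.indicator_of_notMem hy, ht]
      · simp [Set.indicator_of_notMem hx, hs])
  rw [lintegral_indicator_one m1, lintegral_indicator_one m2, lintegral_indicator_one hW, hA1, hA2,
    ← ENNReal.rpow_add_of_nonneg _ _ hs.le ht.le, hst, ENNReal.rpow_one] at key
  exact key

theorem measure_add_le_of_ball_subset {m : ℕ} {K W : Set (EuclideanSpace ℝ (Fin (m + 2)))}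
    (hK : IsCompact K) (hW : MeasurableSet W) {ε κ B : ℝ} (hε : 0 < ε) (hκ : 0 ≤ κ) (hB : 0 < B)
    (hBn : ENNReal.ofReal (B ^ (m + 2)) =
      volume (Metric.ball (0 : EuclideanSpace ℝ (Fin (m + 2))) 1))
    (hκn : ENNReal.ofReal (κ ^ (m + 2)) ≤ volume K)
    (hKW : ∀ x ∈ K, ∀ y, dist y x ≤ ε → y ∈ W) :
    volume K + ENNReal.ofReal (ε * ((m + 2) * B * κ ^ (m + 1))) ≤ volume W := by
  have hsub : K ⊆ W := fun x hx => hKW x hx x (by simpa using hε.le)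
  rcases hκ.eq_or_lt with rfl | hκ0
  · simpa using measure_mono hsub
  have hfin : volume K ≠ ∞ := hK.measure_lt_top.ne
  set V := (volume K).toReal with hV
  have hVK : ENNReal.ofReal V = volume K := ENNReal.ofReal_toReal hfin
  have hκV : κ ^ (m + 2) ≤ V := by
    rw [← hVK] at hκn
    exact (ENNReal.ofReal_le_ofReal_iff ENNReal.toReal_nonneg).1 hκn
  have hV0 : 0 < V := lt_of_lt_of_le (by positivity) hκV
  set k := V ^ ((m + 2 : ℕ) : ℝ)⁻¹ with hk
  have hk0 : 0 < k := by positivity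
  have hkn : k ^ (m + 2) = V := Real.rpow_inv_natCast_pow hV0.le (by simp)
  have hκk : κ ≤ k := by
    rw [← hkn] at hκV
    exact (pow_le_pow_iff_left₀ hκ hk0.le (by simp)).1 hκV
  refine le_trans ?_ (brunnMinkowski_ball hK.measurableSet hW hε hk0 hB hBn (by rw [hkn, hVK]) hKW)
  rw [← hVK, ← ENNReal.ofReal_add hV0.le (by positivity)]
  refine ENNReal.ofReal_le_ofReal ?_
  have := pow_add_mul_pow_le_add_pow hk0.le (mul_pos hε hB).le (m + 1)
  rw [hkn] at this
  refine le_trans ?_ this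
  have h2 : κ ^ (m + 1) ≤ k ^ (m + 1) := by gcongr
  have h3 : ε * ((m + 2) * B * κ ^ (m + 1)) ≤ ε * ((m + 2) * B * k ^ (m + 1)) := by gcongr
  push_cast
  linarith

section

variable {m : ℕ}

local notation "E" => EuclideanSpace ℝ (Fin (m + 2))

theorem exists_forall_abs_sub_le {F : Type*} [NormedAddCommGroup F] [NormedSpace ℝ F]
    [FiniteDimensional ℝ F] {u : F → ℝ} (hu : ContDiff ℝ 1 u) (hc : HasCompactSupport u)
    {η : ℝ} (hη : 0 < η) : ∃ ε₀ > 0, ∀ ε, 0 < ε → ε < ε₀ → ∀ x y, dist y x ≤ ε →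
      |u y - u x| ≤ ε * (‖fderiv ℝ u x‖ + η) := by
  have huc : UniformContinuous (fderiv ℝ u) :=
    (hc.fderiv (𝕜 := ℝ)).uniformContinuous_of_continuous (hu.continuous_fderiv (by simp))
  obtain ⟨ε₀, hε₀, H⟩ := Metric.uniformContinuous_iff.1 huc η hη
  refine ⟨ε₀, hε₀, fun ε hε hlt x y hxy => ?_⟩
  have := (convex_closedBall x ε).norm_image_sub_le_of_norm_fderiv_le (𝕜 := ℝ) (f := u)
    (C := ‖fderiv ℝ u x‖ + η) (fun z _ => (hu.differentiable (by simp)).differentiableAt) (fun z hz => ?_)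
    (Metric.mem_closedBall_self hε.le) (Metric.mem_closedBall.2 hxy)
  · rw [Real.norm_eq_abs] at this
    refine this.trans ?_
    rw [mul_comm, ← dist_eq_norm]
    gcongr
  · have hz' : dist z x < ε₀ := lt_of_le_of_lt hz hlt
    have := (H hz').le
    rw [dist_eq_norm] at this
    have := norm_le_insert' (fderiv ℝ u z) (fderiv ℝ u x)
    linarith

theorem isCompact_le_abs {F : Type*} [TopologicalSpace F] {u : F → ℝ}
    (hu : Continuous u) (hc : HasCompactSupport u) {t : ℝ} (ht : 0 < t) :
    IsCompact {x | t ≤ |u x|} := by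
  refine hc.isCompact.of_isClosed_subset (isClosed_le continuous_const hu.abs) fun x hx => ?_
  refine subset_tsupport u ?_
  have hx' : t ≤ |u x| := hx
  exact abs_pos.1 (ht.trans_le hx')

theorem ofReal_mul_le_setLIntegral_norm_fderiv_add {u : E → ℝ} (hu : ContDiff ℝ 1 u)
    (hc : HasCompactSupport u)
    {κ B : ℝ} (hκ : 0 ≤ κ) (hB : 0 < B)
    (hBn : ENNReal.ofReal (B ^ (m + 2)) = volume (Metric.ball (0 : E) 1))
    {a' a b η : ℝ} (ha' : 0 < a') (haa : a' < a) (hη : 0 < η)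
    (hκn : ENNReal.ofReal (κ ^ (m + 2)) ≤ volume {x | b ≤ |u x|}) :
    ENNReal.ofReal ((b - a) * ((m + 2) * B * κ ^ (m + 1))) ≤
      ∫⁻ x in {x | a' ≤ |u x| ∧ |u x| ≤ b}, ENNReal.ofReal (‖fderiv ℝ u x‖ + η) := by
  obtain ⟨ε₀, hε₀, H⟩ := exists_forall_abs_sub_le hu hc hη
  have hcD : Continuous (fderiv ℝ u) := hu.continuous_fderiv (by simp)
  obtain ⟨L, hL⟩ := (hc.fderiv (𝕜 := ℝ)).exists_bound_of_continuous hcD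
  have hL0 : 0 ≤ L := (norm_nonneg _).trans (hL 0)
  obtain ⟨ε, hε, hεlt⟩ := exists_between (lt_min hε₀ (div_pos (sub_pos.2 haa) (by positivity : 0 < L + η)))
  have hεε₀ := hεlt.trans_le (min_le_left _ _)
  have hεL : ε * (L + η) < a - a' := (lt_div_iff₀ (by positivity)).1 (hεlt.trans_le (min_le_right _ _))
  set c := (m + 2) * B * κ ^ (m + 1)
  have hc0 : 0 ≤ c := by positivity
  set w : E → ℝ := fun x => |u x| + ε * (‖fderiv ℝ u x‖ + η) with hw
  have hwc : Continuous w := by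
    have := hu.continuous
    fun_prop
  have hslice : ∀ t, a < t → t < b →
      ENNReal.ofReal (ε * c) ≤ volume {x | |u x| < t ∧ t ≤ w x} := by
    intro t hat htb
    have hK := isCompact_le_abs hu.continuous hc ((ha'.trans haa).trans hat)
    have hWm : MeasurableSet {x | t ≤ w x} := measurableSet_le measurable_const hwc.measurable
    have h1 := measure_add_le_of_ball_subset hK hWm hε hκ hB hBn
      (hκn.trans (measure_mono fun x hx => htb.le.trans hx)) (by
        intro x hx y hxy
        have hx' : t ≤ |u x| := hx
        have h3 := H ε hε hεε₀ y x (by rwa [dist_comm])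
        have h4 := abs_sub_abs_le_abs_sub (u x) (u y)
        show t ≤ w y
        simp only [hw]
        linarith)
    have h2 : volume {x | t ≤ w x} ≤ volume {x | t ≤ |u x|} + volume {x | |u x| < t ∧ t ≤ w x} := by
      refine (measure_mono fun x hx => ?_).trans (measure_union_le _ _)
      rcases le_or_gt t |u x| with h | h
      · exact Or.inl h
      · exact Or.inr ⟨h, hx⟩
    exact (ENNReal.add_le_add_iff_left hK.measure_lt_top.ne).1 (h1.trans h2)
  set S : Set (ℝ × E) := {p | (a < p.1 ∧ p.1 < b) ∧ |u p.2| < p.1 ∧ p.1 ≤ w p.2} with hS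
  have huc := hu.continuous
  have hSm : MeasurableSet S := by
    refine ((measurableSet_lt measurable_const measurable_fst).inter
      (measurableSet_lt measurable_fst measurable_const)).inter
      ((measurableSet_lt ?_ measurable_fst).inter (measurableSet_le measurable_fst ?_))
    · exact (huc.abs.measurable).comp measurable_snd
    · exact hwc.measurable.comp measurable_snd
  have hlow : ENNReal.ofReal ε * ENNReal.ofReal ((b - a) * c) ≤ (volume.prod volume) S := by
    rw [Measure.prod_apply hSm]
    calc ENNReal.ofReal ε * ENNReal.ofReal ((b - a) * c)
        = ∫⁻ t in Set.Ioo a b, ENNReal.ofReal (ε * c) := by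
          rw [setLIntegral_const, Real.volume_Ioo, ← ENNReal.ofReal_mul hε.le,
            ← ENNReal.ofReal_mul (by positivity)]
          congr 1
          ring
      _ ≤ ∫⁻ t in Set.Ioo a b, volume (Prod.mk t ⁻¹' S) := by
          refine setLIntegral_mono' measurableSet_Ioo fun t ht => (hslice t ht.1 ht.2).trans ?_
          exact measure_mono fun x hx => ⟨ht, hx⟩
      _ ≤ _ := setLIntegral_le_lintegral _ _
  have hTm : MeasurableSet {x : E | a' ≤ |u x| ∧ |u x| ≤ b} :=
    (measurableSet_le measurable_const huc.abs.measurable).inter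
      (measurableSet_le huc.abs.measurable measurable_const)
  have hup : (volume.prod volume) S ≤ ENNReal.ofReal ε *
      ∫⁻ x in {x | a' ≤ |u x| ∧ |u x| ≤ b}, ENNReal.ofReal (‖fderiv ℝ u x‖ + η) := by
    rw [Measure.prod_apply_symm hSm, ← lintegral_const_mul _ (by fun_prop),
      ← lintegral_indicator hTm]
    refine lintegral_mono fun x => ?_
    by_cases hx : x ∈ {x : E | a' ≤ |u x| ∧ |u x| ≤ b}
    · rw [Set.indicator_of_mem hx, ← ENNReal.ofReal_mul hε.le]
      have : ε * (‖fderiv ℝ u x‖ + η) = w x - |u x| := by simp [hw]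
      rw [this, ← Real.volume_Ioc]
      exact measure_mono fun t ht => ht.2
    · rw [Set.indicator_of_notMem hx, nonpos_iff_eq_zero]
      convert measure_empty (μ := (volume : Measure ℝ))
      refine Set.eq_empty_of_forall_notMem fun t ht => hx ?_
      obtain ⟨⟨h1, h2⟩, h3, h4⟩ := ht
      dsimp only at h1 h2 h3 h4
      refine ⟨?_, (h3.trans h2).le⟩
      have : ε * (‖fderiv ℝ u x‖ + η) ≤ ε * (L + η) := by gcongr; exact hL x
      simp only [hw] at h4
      linarith
  exact (ENNReal.mul_le_mul_iff_right (by simpa using hε) ENNReal.ofReal_ne_top).1 (hlow.trans hup)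

/-- The coarea and isoperimetric inequalities combined: a lower bound for the integral of the
gradient between two levels, in terms of the measure of the higher superlevel set. -/
theorem ofReal_mul_le_setLIntegral_norm_fderiv {u : E → ℝ} (hu : ContDiff ℝ 1 u)
    (hc : HasCompactSupport u) {κ B : ℝ} (hκ : 0 ≤ κ) (hB : 0 < B)
    (hBn : ENNReal.ofReal (B ^ (m + 2)) = volume (Metric.ball (0 : E) 1))
    {a b : ℝ} (ha : 0 < a)
    (hκn : ENNReal.ofReal (κ ^ (m + 2)) ≤ volume {x | b ≤ |u x|}) :
    ENNReal.ofReal ((b - a) * ((m + 2) * B * κ ^ (m + 1))) ≤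
      ∫⁻ x in {x | a < |u x| ∧ |u x| ≤ b}, ENNReal.ofReal ‖fderiv ℝ u x‖ := by
  rcases le_or_gt b a with hba | hab
  · rw [ENNReal.ofReal_of_nonpos (mul_nonpos_of_nonpos_of_nonneg (by linarith) (by positivity))]
    exact zero_le
  have lim1 : Filter.Tendsto (fun a₂ => ENNReal.ofReal ((b - a₂) * ((m + 2) * B * κ ^ (m + 1))))
      (nhdsWithin a (Set.Ioi a)) (nhds (ENNReal.ofReal ((b - a) * ((m + 2) * B * κ ^ (m + 1))))) := by
    refine Filter.Tendsto.mono_left ?_ nhdsWithin_le_nhds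
    exact (ENNReal.continuous_ofReal.comp (by fun_prop)).tendsto _
  refine le_of_tendsto lim1 ?_
  filter_upwards [Ioo_mem_nhdsGT hab] with a₂ ha₂
  obtain ⟨a', haa', ha'⟩ := exists_between ha₂.1
  set S := {x : E | a' ≤ |u x| ∧ |u x| ≤ b}
  have hcD : Continuous (fderiv ℝ u) := hu.continuous_fderiv (by simp)
  have hSfin : volume S ≠ ∞ := ((measure_mono fun x hx => hx.1).trans_lt
    (isCompact_le_abs hu.continuous hc (ha.trans haa')).measure_lt_top).ne
  have key : ENNReal.ofReal ((b - a₂) * ((m + 2) * B * κ ^ (m + 1))) ≤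
      ∫⁻ x in S, ENNReal.ofReal ‖fderiv ℝ u x‖ := by
    have lim2 : Filter.Tendsto (fun η : ℝ =>
        (∫⁻ x in S, ENNReal.ofReal ‖fderiv ℝ u x‖) + ENNReal.ofReal η * volume S)
        (nhdsWithin 0 (Set.Ioi 0)) (nhds ((∫⁻ x in S, ENNReal.ofReal ‖fderiv ℝ u x‖) +
          ENNReal.ofReal 0 * volume S)) := by
      refine Filter.Tendsto.mono_left ?_ nhdsWithin_le_nhds
      refine tendsto_const_nhds.add (ENNReal.Tendsto.mul_const ?_ (Or.inr hSfin))
      exact ENNReal.continuous_ofReal.tendsto 0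
    simp only [ENNReal.ofReal_zero, zero_mul, add_zero] at lim2
    refine ge_of_tendsto lim2 ?_
    filter_upwards [self_mem_nhdsWithin] with η hη
    refine (ofReal_mul_le_setLIntegral_norm_fderiv_add hu hc hκ hB hBn (ha.trans haa') ha' hη
      hκn).trans ?_
    rw [← setLIntegral_const, ← lintegral_add_left (by fun_prop)]
    exact lintegral_mono fun x => ENNReal.ofReal_add_le
  exact key.trans (lintegral_mono_set fun x hx => ⟨haa'.trans_le hx.1, hx.2⟩)

end

theorem setLIntegral_pow_le {X : Type*} [MeasurableSpace X] {μ : Measure X} {f : X → ℝ≥0∞}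
    (hf : Measurable f) (S : Set X) (m : ℕ) :
    (∫⁻ x in S, f x ∂μ) ^ (m + 2) ≤ (∫⁻ x in S, f x ^ (m + 2) ∂μ) * μ S ^ (m + 1) := by
  have hp : (1 : ℝ) < ((m + 2 : ℕ) : ℝ) := by exact_mod_cast (by omega : 1 < m + 2)
  have hpq := Real.HolderConjugate.conjExponent hp
  have h := ENNReal.lintegral_mul_le_Lp_mul_Lq (μ.restrict S) hpq hf.aemeasurable
    (measurable_one (α := ℝ≥0∞)).aemeasurable
  simp only [Pi.mul_apply, Pi.one_apply, mul_one, ENNReal.one_rpow, lintegral_const,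
    Measure.restrict_apply_univ, one_mul] at h
  calc (∫⁻ x in S, f x ∂μ) ^ (m + 2) ≤ ((∫⁻ x in S, f x ^ ((m + 2 : ℕ) : ℝ) ∂μ) ^ (1 / ((m + 2 : ℕ) : ℝ)) *
        μ S ^ (1 / Real.conjExponent ((m + 2 : ℕ) : ℝ))) ^ (m + 2) := by gcongr
    _ = (∫⁻ x in S, f x ^ (m + 2) ∂μ) * μ S ^ (m + 1) := by
      rw [mul_pow, ← ENNReal.rpow_natCast, ← ENNReal.rpow_mul, ← ENNReal.rpow_natCast (_ ^ _),
        ← ENNReal.rpow_mul, ← ENNReal.rpow_natCast (μ S)]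
      congr 1
      · simp only [ENNReal.rpow_natCast]
        rw [one_div_mul_cancel (by positivity), ENNReal.rpow_one]
      · congr 1
        simp only [Real.conjExponent]
        push_cast
        field_simp
        ring

theorem sub_pow_mul_le_of_exp_sub_one {m : ℕ} {q : ℝ} (hq : 0 ≤ q) {ψ H : ℝ → ℝ} (hψ : Monotone ψ)
    (h : ∀ s s', 0 ≤ s → s ≤ s' →
      (ψ s' - ψ s) ^ (m + 2) * q ≤ (H s - H s') * (Real.exp (s' - s) - 1) ^ (m + 1))
    {s s' : ℝ} (hs : 0 ≤ s) (hss : s ≤ s') :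
    (ψ s' - ψ s) ^ (m + 2) * q ≤ (H s - H s') * (s' - s) ^ (m + 1) := by
  set L := s' - s with hL
  have hL0 : 0 ≤ L := sub_nonneg.2 hss
  have key : ∀ N : ℕ, (ψ s' - ψ s) ^ (m + 2) * q ≤
      (H s - H s') * (((N : ℝ) + 1) * (Real.exp (L / (N + 1)) - 1)) ^ (m + 1) := by
    intro N
    have hN : (0 : ℝ) < N + 1 := by positivity
    set δ := L / (N + 1) with hδ
    have hδ0 : 0 ≤ δ := by positivity
    set p : ℕ → ℝ := fun i => s + i * δ with hp
    have hpN : p (N + 1) = s' := by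
      simp only [hp, hδ, hL]
      push_cast
      field_simp
      ring
    have hp0 : p 0 = s := by simp [hp]
    have hpd : ∀ i, p (i + 1) - p i = δ := fun i => by simp only [hp]; push_cast; ring
    have hple : ∀ i, p i ≤ p (i + 1) := fun i => by linarith [hpd i]
    have hpge : ∀ i, 0 ≤ p i := fun i => by simp only [hp]; positivity
    have hsum := pow_sum_div_card_le_sum_pow (s := Finset.range (N + 1))
      (f := fun i => ψ (p (i + 1)) - ψ (p i)) (fun i _ => sub_nonneg.2 (hψ (hple i))) (m + 1)
    rw [Finset.sum_range_sub (fun i => ψ (p i)), hpN, hp0, Finset.card_range,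
      div_le_iff₀ (by positivity)] at hsum
    have hsum2 : (∑ i ∈ Finset.range (N + 1), (ψ (p (i + 1)) - ψ (p i)) ^ (m + 2)) * q ≤
        (H s - H s') * (Real.exp δ - 1) ^ (m + 1) := by
      rw [Finset.sum_mul]
      calc _ ≤ ∑ i ∈ Finset.range (N + 1), (H (p i) - H (p (i + 1))) * (Real.exp δ - 1) ^ (m + 1) :=
            Finset.sum_le_sum fun i _ => by
              have := h (p i) (p (i + 1)) (hpge i) (hple i)
              rwa [hpd] at this
        _ = _ := by rw [← Finset.sum_mul, Finset.sum_range_sub' (fun i => H (p i)), hpN, hp0]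
    calc (ψ s' - ψ s) ^ (m + 2) * q
        ≤ ((∑ i ∈ Finset.range (N + 1), (ψ (p (i + 1)) - ψ (p i)) ^ (m + 2)) *
          ((N + 1 : ℕ) : ℝ) ^ (m + 1)) * q := by gcongr
      _ = ((∑ i ∈ Finset.range (N + 1), (ψ (p (i + 1)) - ψ (p i)) ^ (m + 2)) * q) *
          ((N : ℝ) + 1) ^ (m + 1) := by push_cast; ring
      _ ≤ ((H s - H s') * (Real.exp δ - 1) ^ (m + 1)) * ((N : ℝ) + 1) ^ (m + 1) := by gcongr
      _ = _ := by rw [mul_pow]; ring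
  have lim : Filter.Tendsto (fun N : ℕ => ((N : ℝ) + 1) * (Real.exp (L / (N + 1)) - 1))
      Filter.atTop (nhds L) := by
    have hd : HasDerivAt (fun x : ℝ => Real.exp (x * L)) L 0 := by
      have := ((hasDerivAt_id (0 : ℝ)).mul_const L).exp
      simpa using this
    have := hd.tendsto_slope_zero_right.comp
      (g := fun t : ℝ => t⁻¹ • (Real.exp ((0 + t) * L) - Real.exp (0 * L)))
      (f := fun N : ℕ => 1 / ((N : ℝ) + 1)) (x := Filter.atTop) ?_
    · refine this.congr fun N => ?_
      simp only [Function.comp, zero_add, zero_mul, Real.exp_zero, smul_eq_mul, one_div, inv_inv]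
      rw [inv_mul_eq_div]
    · refine tendsto_nhdsWithin_iff.2 ⟨tendsto_one_div_add_atTop_nhds_zero_nat, ?_⟩
      exact Filter.Eventually.of_forall fun N => Set.mem_Ioi.2 Nat.one_div_pos_of_nat
  exact ge_of_tendsto' ((lim.pow (m + 1)).const_mul _) key

/-- The decreasing rearrangement above level `A` of a function with distribution function `N`. -/
noncomputable def rearrange (N : ℝ → ℝ) (A y : ℝ) : ℝ := sInf {t | A ≤ t ∧ N t ≤ y}

section rearrange

variable {N : ℝ → ℝ} {A : ℝ}

theorem le_rearrange (hT : ∃ T, A ≤ T ∧ N T = 0) {y : ℝ} (hy : 0 ≤ y) : A ≤ rearrange N A y := by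
  obtain ⟨T, hAT, hT⟩ := hT
  exact le_csInf ⟨T, hAT, hT.trans_le hy⟩ fun t ht => ht.1

theorem rearrange_le {t y : ℝ} (ht : A ≤ t) (hty : N t ≤ y) : rearrange N A y ≤ t :=
  csInf_le ⟨A, fun _ h => h.1⟩ ⟨ht, hty⟩

theorem rearrange_antitone (hT : ∃ T, A ≤ T ∧ N T = 0) {y y' : ℝ} (hy : 0 ≤ y) (h : y ≤ y') :
    rearrange N A y' ≤ rearrange N A y := by
  obtain ⟨T, hAT, hT⟩ := hT
  exact csInf_le_csInf ⟨A, fun _ h => h.1⟩ ⟨T, hAT, hT.trans_le hy⟩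
    fun t ht => ⟨ht.1, ht.2.trans h⟩

theorem apply_rearrange_le (hN : AntitoneOn N (Set.Ici A)) (hT : ∃ T, A ≤ T ∧ N T = 0)
    (hr : ∀ t, A ≤ t → ∀ y, (∀ t' > t, N t' ≤ y) → N t ≤ y) {y : ℝ} (hy : 0 ≤ y) :
    N (rearrange N A y) ≤ y := by
  refine hr _ (le_rearrange hT hy) y fun t' ht' => ?_
  obtain ⟨T, hAT, hT0⟩ := hT
  obtain ⟨t, ht, htt'⟩ := exists_lt_of_csInf_lt (s := {t | A ≤ t ∧ N t ≤ y})
    ⟨T, hAT, hT0.trans_le hy⟩ ht'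
  exact (hN ht.1 (ht.1.trans htt'.le) htt'.le).trans ht.2

theorem lt_rearrange_iff (hN : AntitoneOn N (Set.Ici A)) (hT : ∃ T, A ≤ T ∧ N T = 0)
    (hr : ∀ t, A ≤ t → ∀ y, (∀ t' > t, N t' ≤ y) → N t ≤ y) {y t : ℝ} (hy : 0 ≤ y) (ht : A ≤ t) :
    t < rearrange N A y ↔ y < N t := by
  constructor
  · intro h
    by_contra hcon
    exact absurd (rearrange_le ht (not_lt.1 hcon)) (not_le.2 h)
  · intro h
    by_contra hcon
    have h1 := hN (le_rearrange hT hy) ht (not_lt.1 hcon)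
    exact absurd (h1.trans (apply_rearrange_le hN hT hr hy)) (not_le.2 h)

theorem rearrange_sub_pow_mul_le {m : ℕ} {q : ℝ} {G : ℝ → ℝ}
    (hN : AntitoneOn N (Set.Ici A)) (hT : ∃ T, A ≤ T ∧ N T = 0)
    (hr : ∀ t, A ≤ t → ∀ y, (∀ t' > t, N t' ≤ y) → N t ≤ y)
    (hG : AntitoneOn G (Set.Ici A))
    (h : ∀ a b, A ≤ a → a ≤ b →
      (b - a) ^ (m + 2) * q * N b ^ (m + 1) ≤ (G a - G b) * (N a - N b) ^ (m + 1))
    {s s' : ℝ} (hss : s ≤ s') :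
    (rearrange N A (Real.exp (-s')) - rearrange N A (Real.exp (-s))) ^ (m + 2) * q ≤
      (G (rearrange N A (Real.exp (-s))) - G (rearrange N A (Real.exp (-s')))) *
        (Real.exp (s' - s) - 1) ^ (m + 1) := by
  set a := rearrange N A (Real.exp (-s)) with ha
  set c := rearrange N A (Real.exp (-s')) with hc
  have hAa : A ≤ a := le_rearrange hT (Real.exp_nonneg _)
  have hac : a ≤ c := rearrange_antitone hT (Real.exp_nonneg _) (by gcongr)
  rcases hac.eq_or_lt with hac' | hac'
  · simp [hac']
  have key : ∀ b, a < b → b < c → (b - a) ^ (m + 2) * q ≤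
      (G a - G c) * (Real.exp (s' - s) - 1) ^ (m + 1) := by
    intro b hab hbc
    have hAb := hAa.trans hab.le
    have hNb : Real.exp (-s') < N b :=
      (lt_rearrange_iff hN hT hr (Real.exp_nonneg _) hAb).1 hbc
    have hNb0 : 0 < N b := (Real.exp_pos _).trans hNb
    have hNa : N a ≤ Real.exp (-s) := apply_rearrange_le hN hT hr (Real.exp_nonneg _)
    have hNab : N b ≤ N a := hN hAa hAb hab.le
    have hGbc : G c ≤ G b := hG hAb (hAb.trans hbc.le) hbc.le
    have hGab : G b ≤ G a := hG hAa hAb hab.le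
    have h1 : N a - N b ≤ (Real.exp (s' - s) - 1) * N b := by
      have : Real.exp (-s) = Real.exp (s' - s) * Real.exp (-s') := by
        rw [← Real.exp_add]; ring_nf
      nlinarith [Real.exp_pos (s' - s)]
    refine le_of_mul_le_mul_right ?_ (pow_pos hNb0 (m + 1))
    calc (b - a) ^ (m + 2) * q * N b ^ (m + 1) ≤ (G a - G b) * (N a - N b) ^ (m + 1) :=
          h a b hAa hab.le
      _ ≤ (G a - G c) * ((Real.exp (s' - s) - 1) * N b) ^ (m + 1) := by
          gcongr
          linarith
      _ = _ := by rw [mul_pow]; ring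
  have lim : Filter.Tendsto (fun b => (b - a) ^ (m + 2) * q) (nhdsWithin c (Set.Iio c))
      (nhds ((c - a) ^ (m + 2) * q)) :=
    (Continuous.tendsto (by fun_prop) c).mono_left nhdsWithin_le_nhds
  refine le_of_tendsto lim ?_
  filter_upwards [Ioo_mem_nhdsLT hac'] with b hb
  exact key b hb.1 hb.2

end rearrange

theorem add_rpow_le_of_add_eq_one {a b p q e : ℝ} (ha : 0 ≤ a) (hb : 0 ≤ b) (hp : 0 < p)
    (hq : 0 < q) (hpq : p + q = 1) (he : 0 ≤ e) :
    (a + b) ^ (1 + e) ≤ p ^ (-e) * a ^ (1 + e) + q ^ (-e) * b ^ (1 + e) := by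
  have aux : ∀ {x c : ℝ}, 0 ≤ x → 0 < c → c * (x / c) ^ (1 + e) = c ^ (-e) * x ^ (1 + e) := by
    intro x c hx hc
    rw [Real.div_rpow hx hc.le, Real.rpow_add hc, Real.rpow_one, Real.rpow_neg hc.le]
    field_simp
  have h := (convexOn_rpow (p := 1 + e) (by linarith)).2 (x := a / p) (y := b / q)
    (Set.mem_Ici.2 (by positivity)) (Set.mem_Ici.2 (by positivity)) hp.le hq.le hpq
  simp only [smul_eq_mul] at h
  rwa [aux ha hp, aux hb hq, mul_div_cancel₀ _ hp.ne', mul_div_cancel₀ _ hq.ne'] at h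

theorem rpow_one_add_inv_pow {x : ℝ} (hx : 0 ≤ x) (m : ℕ) :
    (x ^ (1 + ((m : ℝ) + 1)⁻¹)) ^ (m + 1) = x ^ (m + 2) := by
  rw [← Real.rpow_natCast, ← Real.rpow_mul hx, ← Real.rpow_natCast]
  congr 1
  push_cast
  field_simp
  ring

theorem rpow_one_add_inv_le {m : ℕ} {x c L : ℝ} (hx : 0 ≤ x) (hc : 0 ≤ c) (hL : 0 ≤ L)
    (h : x ^ (m + 2) ≤ c * L ^ (m + 1)) :
    x ^ (1 + ((m : ℝ) + 1)⁻¹) ≤ c ^ ((m : ℝ) + 1)⁻¹ * L := by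
  refine (pow_le_pow_iff_left₀ (by positivity) (by positivity) (by simp : m + 1 ≠ 0)).1 ?_
  rw [rpow_one_add_inv_pow hx, mul_pow]
  refine h.trans_eq ?_
  congr 1
  have : ((m : ℝ) + 1) = ((m + 1 : ℕ) : ℝ) := by push_cast; rfl
  rw [this, Real.rpow_inv_natCast_pow hc (by simp)]

theorem sub_le_of_le_rpow {m : ℕ} {lam s₁ s₂ φ₁ φ₂ h : ℝ} (hlam : 0 < lam)
    (hs₁ : 2 ^ (m + 2) * (m + 1) * lam ≤ s₁) (hs : s₁ ≤ s₂) (hφ₁ : 0 ≤ φ₁) (hφ : φ₁ ≤ φ₂)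
    (h0 : 0 ≤ h) (h1 : h ≤ 1) (H₁ : φ₁ ^ (m + 2) ≤ (1 - h) * s₁ ^ (m + 1))
    (H₂ : (φ₂ - φ₁) ^ (m + 2) ≤ h * (s₂ - s₁) ^ (m + 1))
    (E₁ : s₁ - lam ≤ φ₁ ^ (1 + ((m : ℝ) + 1)⁻¹))
    (E₂ : s₂ - lam ≤ φ₂ ^ (1 + ((m : ℝ) + 1)⁻¹)) :
    s₂ - s₁ ≤ (2 + 2 ^ (m + 3) * (m + 1)) * lam := by
  set e : ℝ := ((m : ℝ) + 1)⁻¹ with he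
  have he0 : 0 ≤ e := by positivity
  have he1 : e ≤ 1 := inv_le_one_of_one_le₀ (by linarith [(Nat.cast_nonneg m : (0 : ℝ) ≤ m)])
  have hs₁0 : 0 < s₁ := lt_of_lt_of_le (by positivity) hs₁
  have hlams : lam ≤ s₁ := by
    refine le_trans ?_ hs₁
    have : (1 : ℝ) ≤ 2 ^ (m + 2) * (m + 1) := by
      have := one_le_pow₀ (n := m + 2) (by norm_num : (1 : ℝ) ≤ 2)
      nlinarith [(Nat.cast_nonneg m : (0 : ℝ) ≤ m)]
    nlinarith
  have hh : h ≤ (m + 1) * lam / s₁ := by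
    have h2 : (s₁ - lam) ^ (m + 1) ≤ (1 - h) * s₁ ^ (m + 1) := by
      refine le_trans ?_ H₁
      rw [← rpow_one_add_inv_pow hφ₁]
      exact pow_le_pow_left₀ (sub_nonneg.2 hlams) E₁ _
    have h3 : 1 + ((m + 1 : ℕ) : ℝ) * (-(lam / s₁)) ≤ (1 + -(lam / s₁)) ^ (m + 1) := by
      refine one_add_mul_le_pow ?_ _
      have : lam / s₁ ≤ 1 := (div_le_one hs₁0).2 hlams
      linarith
    have h4 : (1 + -(lam / s₁)) ^ (m + 1) ≤ 1 - h := by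
      have : s₁ - lam = (1 + -(lam / s₁)) * s₁ := by field_simp; ring
      rw [this, mul_pow] at h2
      exact le_of_mul_le_mul_right h2 (by positivity)
    have h5 := h3.trans h4
    push_cast at h5
    rw [mul_div_assoc]
    linarith
  set q := 2 ^ (m + 1) * ((m + 1) * lam / s₁) with hq
  have hq0 : 0 < q := by positivity
  have hqs : q * s₁ = 2 ^ (m + 1) * (m + 1) * lam := by simp only [hq]; field_simp
  have hq1 : q ≤ 1 / 2 := by
    refine le_of_mul_le_mul_right ?_ hs₁0
    rw [hqs]
    have : (2 : ℝ) ^ (m + 2) = 2 * 2 ^ (m + 1) := by ring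
    rw [this] at hs₁
    linarith
  have hJ := add_rpow_le_of_add_eq_one hφ₁ (sub_nonneg.2 hφ) (p := 1 - q) (q := q) (e := e)
    (by linarith) hq0 (by ring) he0
  rw [add_sub_cancel] at hJ
  have T₁ : (1 - q) ^ (-e) * φ₁ ^ (1 + e) ≤ s₁ + 2 * (q * s₁) := by
    have a1 : φ₁ ^ (1 + e) ≤ s₁ := by
      refine (rpow_one_add_inv_le hφ₁ (by linarith) hs₁0.le H₁).trans ?_
      have : (1 - h) ^ e ≤ 1 := Real.rpow_le_one (by linarith) (by linarith) he0
      nlinarith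
    have a2 : (1 - q) ^ (-e) ≤ 1 + 2 * q := by
      calc (1 - q) ^ (-e) ≤ (1 - q) ^ (-1 : ℝ) :=
            Real.rpow_le_rpow_of_exponent_ge (by linarith) (by linarith) (by linarith)
        _ = (1 - q)⁻¹ := Real.rpow_neg_one _
        _ ≤ 1 + 2 * q := by
          rw [inv_le_iff_one_le_mul₀ (by linarith)]
          nlinarith
    calc _ ≤ (1 + 2 * q) * s₁ := by gcongr
      _ = _ := by ring
  have T₂ : q ^ (-e) * (φ₂ - φ₁) ^ (1 + e) ≤ (s₂ - s₁) / 2 := by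
    have a1 := rpow_one_add_inv_le (sub_nonneg.2 hφ) h0 (sub_nonneg.2 hs) H₂
    have a2 : q ^ (-e) * h ^ e ≤ 1 / 2 := by
      have b1 : h ≤ q * (1 / 2) ^ (m + 1) := by
        simp only [hq]
        rw [mul_right_comm, ← mul_pow]
        norm_num
        exact hh
      have b2 : h ^ e ≤ q ^ e * (1 / 2) := by
        calc h ^ e ≤ (q * (1 / 2) ^ (m + 1)) ^ e := by gcongr
          _ = q ^ e * (1 / 2) := by
            rw [Real.mul_rpow hq0.le (by positivity)]
            congr 1
            have : e = ((m + 1 : ℕ) : ℝ)⁻¹ := by rw [he]; push_cast; rfl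
            rw [this, Real.pow_rpow_inv_natCast (by norm_num) (by simp)]
      calc q ^ (-e) * h ^ e ≤ q ^ (-e) * (q ^ e * (1 / 2)) := by gcongr
        _ = 1 / 2 := by rw [← mul_assoc, ← Real.rpow_add hq0]; simp
    calc q ^ (-e) * (φ₂ - φ₁) ^ (1 + e) ≤ q ^ (-e) * (h ^ e * (s₂ - s₁)) := by gcongr
      _ = (q ^ (-e) * h ^ e) * (s₂ - s₁) := by ring
      _ ≤ 1 / 2 * (s₂ - s₁) := by gcongr
      _ = _ := by ring
  have e1 : (2 : ℝ) ^ (m + 3) = 4 * 2 ^ (m + 1) := by ring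
  rw [e1]
  rw [hqs] at T₁
  linarith

theorem subset_Icc_union_Icc {m : ℕ} {φ h : ℝ → ℝ} (φ0 : ∀ s, 0 ≤ s → 0 ≤ φ s)
    (φm : ∀ s s', 0 ≤ s → s ≤ s' → φ s ≤ φ s') (h0 : ∀ s, 0 ≤ s → 0 ≤ h s)
    (h1 : ∀ s, 0 ≤ s → h s ≤ 1)
    (H₁ : ∀ s, 0 ≤ s → φ s ^ (m + 2) ≤ (1 - h s) * s ^ (m + 1))
    (H₂ : ∀ s s', 0 ≤ s → s ≤ s' → (φ s' - φ s) ^ (m + 2) ≤ h s * (s' - s) ^ (m + 1))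
    {lam : ℝ} (hlam : 0 < lam) :
    ∃ p, {s | 0 ≤ s ∧ s - lam ≤ φ s ^ (1 + ((m : ℝ) + 1)⁻¹)} ⊆
      Set.Icc 0 (0 + 2 ^ (m + 2) * (m + 1) * lam) ∪
        Set.Icc p (p + (2 + 2 ^ (m + 3) * (m + 1)) * lam) := by
  set T := {s | 2 ^ (m + 2) * (m + 1) * lam ≤ s ∧ s - lam ≤ φ s ^ (1 + ((m : ℝ) + 1)⁻¹)}
  have hT0 : ∀ s ∈ T, 0 ≤ s := fun s hs => le_trans (by positivity) hs.1
  have hb : BddBelow T := ⟨0, fun s hs => hT0 s hs⟩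
  refine ⟨sInf T, fun s hs => ?_⟩
  rcases le_or_gt s (2 ^ (m + 2) * (m + 1) * lam) with hsl | hsl
  · exact Or.inl ⟨hs.1, by linarith⟩
  refine Or.inr ?_
  have hsT : s ∈ T := ⟨hsl.le, hs.2⟩
  refine ⟨csInf_le hb hsT, ?_⟩
  rw [← sub_le_iff_le_add]
  refine le_csInf ⟨s, hsT⟩ fun s' hs' => ?_
  have h0' := hT0 s' hs'
  rcases le_total s' s with hle | hle
  · have := sub_le_of_le_rpow hlam hs'.1 hle (φ0 s' h0') (φm s' s h0' hle) (h0 s' h0') (h1 s' h0')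
      (H₁ s' h0') (H₂ s' s h0' hle) hs'.2 hs.2
    linarith
  · have : 0 ≤ (2 + 2 ^ (m + 3) * (m + 1)) * lam := by positivity
    linarith

theorem lintegral_inv_neg_log_le (p : ℝ) {d : ℝ} (hd : 0 ≤ d) :
    ∫⁻ y in Set.Ioo (0 : ℝ) 1, (Set.Icc p (p + d)).indicator 1 (-Real.log y) *
      ENNReal.ofReal y⁻¹ ≤ ENNReal.ofReal d := by
  have hle : Real.exp (-(p + d)) ≤ Real.exp (-p) := by gcongr; linarith
  calc _ ≤ ∫⁻ y in Set.Ioo (0 : ℝ) 1, (Set.Icc (Real.exp (-(p + d))) (Real.exp (-p))).indicator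
        (fun y => ENNReal.ofReal y⁻¹) y := by
        refine setLIntegral_mono' measurableSet_Ioo fun y hy => ?_
        by_cases h : -Real.log y ∈ Set.Icc p (p + d)
        · rw [Set.indicator_of_mem h, Set.indicator_of_mem]
          · simp
          · constructor
            · rw [← Real.le_log_iff_exp_le hy.1]; linarith [h.2]
            · rw [← Real.log_le_iff_le_exp hy.1]; linarith [h.1]
        · simp [Set.indicator_of_notMem h]
    _ ≤ ∫⁻ y, (Set.Icc (Real.exp (-(p + d))) (Real.exp (-p))).indicator
        (fun y => ENNReal.ofReal y⁻¹) y := setLIntegral_le_lintegral _ _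
    _ = ∫⁻ y in Set.Ioc (Real.exp (-(p + d))) (Real.exp (-p)), ENNReal.ofReal y⁻¹ := by
        rw [lintegral_indicator measurableSet_Icc, setLIntegral_congr Ioc_ae_eq_Icc]
    _ = ENNReal.ofReal (∫ y in Real.exp (-(p + d))..Real.exp (-p), y⁻¹) := by
        rw [intervalIntegral.integral_of_le hle, ofReal_integral_eq_lintegral_ofReal]
        · refine (ContinuousOn.integrableOn_Icc (ContinuousOn.inv₀ continuousOn_id ?_)).mono_set
            Set.Ioc_subset_Icc_self
          intro y hy
          exact ((Real.exp_pos _).trans_le hy.1).ne'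
        · refine (ae_restrict_iff' measurableSet_Ioc).2 (Filter.Eventually.of_forall fun y hy => ?_)
          exact inv_nonneg.2 ((Real.exp_pos _).trans hy.1).le
    _ = ENNReal.ofReal d := by
        rw [integral_inv_of_pos (Real.exp_pos _) (Real.exp_pos _), ← Real.exp_sub, Real.log_exp]
        congr 1
        ring

/-- The one-dimensional Moser inequality, for a function whose energy is measured by `h`. -/
theorem exists_lintegral_exp_rpow_le (m : ℕ) : ∃ C : ℝ≥0∞, C ≠ ∞ ∧ ∀ φ h : ℝ → ℝ,
    (∀ s, 0 ≤ s → 0 ≤ φ s) → (∀ s s', 0 ≤ s → s ≤ s' → φ s ≤ φ s') → (∀ s, 0 ≤ s → 0 ≤ h s) →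
    (∀ s, 0 ≤ s → h s ≤ 1) → (∀ s, 0 ≤ s → φ s ^ (m + 2) ≤ (1 - h s) * s ^ (m + 1)) →
    (∀ s s', 0 ≤ s → s ≤ s' → (φ s' - φ s) ^ (m + 2) ≤ h s * (s' - s) ^ (m + 1)) →
    ∫⁻ y in Set.Ioo (0 : ℝ) 1,
      ENNReal.ofReal (Real.exp (φ (-Real.log y) ^ (1 + ((m : ℝ) + 1)⁻¹))) ≤ C := by
  set D₁ : ℝ := 2 ^ (m + 2) * (m + 1) with hD₁
  set D₂ : ℝ := 2 + 2 ^ (m + 3) * (m + 1) with hD₂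
  have hD₁0 : 0 ≤ D₁ := by positivity
  have hD₂0 : 0 ≤ D₂ := by positivity
  have hsummable : Summable fun j : ℕ => Real.exp (-(j : ℝ)) * ((D₁ + D₂) * (j + 1)) := by
    have h1 := Real.summable_pow_mul_exp_neg_nat_mul 1 one_pos
    have h0 := Real.summable_pow_mul_exp_neg_nat_mul 0 one_pos
    refine ((h1.add h0).mul_left (D₁ + D₂)).congr fun j => ?_
    simp
    ring
  refine ⟨∑' j : ℕ, ENNReal.ofReal (Real.exp (-(j : ℝ)) * ((D₁ + D₂) * (j + 1))),
    hsummable.tsum_ofReal_ne_top, ?_⟩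
  intro φ h φ0 φm h0 h1 H₁ H₂
  choose p hp using fun j : ℕ => subset_Icc_union_Icc φ0 φm h0 h1 H₁ H₂
    (lam := (j : ℝ) + 1) (by positivity)
  set g : ℕ → ℝ → ℝ≥0∞ := fun j y => ENNReal.ofReal (Real.exp (-(j : ℝ))) *
    ((Set.Icc 0 (0 + D₁ * ((j : ℝ) + 1))).indicator 1 (-Real.log y) * ENNReal.ofReal y⁻¹ +
      (Set.Icc (p j) (p j + D₂ * ((j : ℝ) + 1))).indicator 1 (-Real.log y) *
        ENNReal.ofReal y⁻¹) with hg
  have meas : ∀ a b : ℝ, Measurable fun y : ℝ =>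
      (Set.Icc a b).indicator (1 : ℝ → ℝ≥0∞) (-Real.log y) * ENNReal.ofReal y⁻¹ := by
    intro a b
    have : Measurable fun y : ℝ => (Set.Icc a b).indicator (1 : ℝ → ℝ≥0∞) (-Real.log y) :=
      (measurable_one.indicator measurableSet_Icc).comp Real.measurable_log.neg
    exact this.mul (measurable_inv.ennreal_ofReal)
  calc _ ≤ ∫⁻ y in Set.Ioo (0 : ℝ) 1, ∑' j, g j y := by
        refine setLIntegral_mono' measurableSet_Ioo fun y hy => ?_
        set s := -Real.log y with hs
        have hs0 : 0 ≤ s := neg_nonneg.2 (Real.log_nonpos hy.1.le hy.2.le)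
        set P := φ s ^ (1 + ((m : ℝ) + 1)⁻¹) with hP
        have hPs : P ≤ s := by
          refine (rpow_one_add_inv_le (φ0 s hs0) (by linarith [h1 s hs0]) hs0 (H₁ s hs0)).trans ?_
          have : (1 - h s) ^ ((m : ℝ) + 1)⁻¹ ≤ 1 :=
            Real.rpow_le_one (by linarith [h1 s hs0]) (by linarith [h0 s hs0]) (by positivity)
          nlinarith
        set j := ⌊s - P⌋₊ with hj
        have hj1 : (j : ℝ) ≤ s - P := Nat.floor_le (sub_nonneg.2 hPs)
        have hj2 : s - P < j + 1 := Nat.lt_floor_add_one _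
        refine le_trans ?_ (ENNReal.le_tsum j)
        have hexp : Real.exp P ≤ Real.exp (-(j : ℝ)) * y⁻¹ := by
          have : y⁻¹ = Real.exp s := by rw [hs, Real.exp_neg, Real.exp_log hy.1]
          rw [this, ← Real.exp_add]
          gcongr
          linarith
        refine (ENNReal.ofReal_le_ofReal hexp).trans ?_
        rw [ENNReal.ofReal_mul (Real.exp_nonneg _)]
        simp only [hg]
        gcongr
        have hmem : s ∈ {s | 0 ≤ s ∧ s - ((j : ℝ) + 1) ≤ φ s ^ (1 + ((m : ℝ) + 1)⁻¹)} :=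
          ⟨hs0, by linarith⟩
        rcases hp j hmem with hm | hm
        · rw [Set.indicator_of_mem hm]
          simp
        · rw [← hs, Set.indicator_of_mem hm]
          simp
    _ = ∑' j, ∫⁻ y in Set.Ioo (0 : ℝ) 1, g j y :=
        lintegral_tsum fun j => (((meas _ _).add (meas _ _)).const_mul _).aemeasurable
    _ ≤ _ := by
        refine ENNReal.tsum_le_tsum fun j => ?_
        simp only [hg]
        rw [lintegral_const_mul _ ((meas _ _).fun_add (meas _ _)), lintegral_add_left (meas _ _),
          ENNReal.ofReal_mul (Real.exp_nonneg _)]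
        gcongr
        calc _ ≤ ENNReal.ofReal (D₁ * ((j : ℝ) + 1)) + ENNReal.ofReal (D₂ * ((j : ℝ) + 1)) :=
              add_le_add (lintegral_inv_neg_log_le _ (by positivity))
                (lintegral_inv_neg_log_le _ (by positivity))
          _ = _ := by
            rw [← ENNReal.ofReal_add (by positivity) (by positivity)]
            congr 1
            ring

theorem exists_lintegral_exp_rearrange_le (m : ℕ) : ∃ C : ℝ≥0∞, C ≠ ∞ ∧
    ∀ (N G : ℝ → ℝ) (A c q : ℝ), AntitoneOn N (Set.Ici A) → (∃ T, A ≤ T ∧ N T = 0) →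
      (∀ t, A ≤ t → ∀ y, (∀ t' > t, N t' ≤ y) → N t ≤ y) → AntitoneOn G (Set.Ici A) →
      (∀ a b, A ≤ a → a ≤ b →
        (b - a) ^ (m + 2) * q * N b ^ (m + 1) ≤ (G a - G b) * (N a - N b) ^ (m + 1)) →
      0 ≤ c → 0 ≤ q → N A ≤ 1 → (∀ t, 0 ≤ G t) → c * G A ≤ 1 →
      ∫⁻ y in Set.Ioo (0 : ℝ) 1, ENNReal.ofReal (Real.exp ((c * q) ^ ((m : ℝ) + 1)⁻¹ *
        (rearrange N A y - A) ^ (1 + ((m : ℝ) + 1)⁻¹))) ≤ C := by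
  obtain ⟨C, hC, H⟩ := exists_lintegral_exp_rpow_le m
  refine ⟨C, hC, fun N G A c q hN hT hr hG h hc hq hNA hG0 hcG => ?_⟩
  set ψ : ℝ → ℝ := fun s => rearrange N A (Real.exp (-s)) with hψ
  have hψm : Monotone ψ := fun s s' hss =>
    rearrange_antitone hT (Real.exp_nonneg _) (by gcongr)
  have hψA : ∀ s, A ≤ ψ s := fun s => le_rearrange hT (Real.exp_nonneg _)
  have hψ0 : ψ 0 = A := le_antisymm (rearrange_le le_rfl (by simpa using hNA)) (hψA 0)
  have hGψ : ∀ s, G (ψ s) ≤ G A := fun s => hG Set.self_mem_Ici (hψA s) (hψA s)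
  have key : ∀ s s', 0 ≤ s → s ≤ s' →
      (ψ s' - ψ s) ^ (m + 2) * q ≤ (G (ψ s) - G (ψ s')) * (s' - s) ^ (m + 1) :=
    fun s s' hs hss => sub_pow_mul_le_of_exp_sub_one (H := fun s => G (ψ s)) hq hψm
      (fun s s' _ hss => rearrange_sub_pow_mul_le hN hT hr hG h hss) hs hss
  set k : ℝ := (c * q) ^ (((m + 2 : ℕ) : ℝ)⁻¹) with hk
  have hcq : 0 ≤ c * q := mul_nonneg hc hq
  have hk0 : 0 ≤ k := Real.rpow_nonneg hcq _
  have hkn : k ^ (m + 2) = c * q := Real.rpow_inv_natCast_pow hcq (by simp)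
  have hkr : k ^ (1 + ((m : ℝ) + 1)⁻¹) = (c * q) ^ ((m : ℝ) + 1)⁻¹ := by
    rw [hk, ← Real.rpow_mul hcq]
    congr 1
    push_cast
    field_simp
    ring
  have main := H (fun s => k * (ψ s - A)) (fun s => c * G (ψ s))
    (fun s _ => mul_nonneg hk0 (sub_nonneg.2 (hψA s)))
    (fun s s' _ hss => by have := hψm hss; gcongr)
    (fun s _ => mul_nonneg hc (hG0 _))
    (fun s _ => (mul_le_mul_of_nonneg_left (hGψ s) hc).trans hcG)
    (fun s hs => by
      have h1 := key 0 s le_rfl hs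
      rw [hψ0, sub_zero] at h1
      rw [mul_pow, hkn]
      calc c * q * (ψ s - A) ^ (m + 2) = c * ((ψ s - A) ^ (m + 2) * q) := by ring
        _ ≤ c * ((G A - G (ψ s)) * s ^ (m + 1)) := by gcongr
        _ = (c * G A - c * G (ψ s)) * s ^ (m + 1) := by ring
        _ ≤ _ := by gcongr)
    (fun s s' hs hss => by
      have h1 := key s s' hs hss
      rw [← mul_sub, mul_pow, hkn, sub_sub_sub_cancel_right]
      have : 0 ≤ s' - s := sub_nonneg.2 hss
      calc c * q * (ψ s' - ψ s) ^ (m + 2) = c * ((ψ s' - ψ s) ^ (m + 2) * q) := by ring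
        _ ≤ c * ((G (ψ s) - G (ψ s')) * (s' - s) ^ (m + 1)) := by gcongr
        _ ≤ c * (G (ψ s) * (s' - s) ^ (m + 1)) := by
          gcongr; linarith [hG0 (ψ s')]
        _ = _ := by ring)
  refine le_trans (le_of_eq (setLIntegral_congr_fun measurableSet_Ioo fun y hy => ?_)) main
  simp only [hψ]
  rw [neg_neg, Real.exp_log hy.1, Real.mul_rpow hk0 (sub_nonneg.2 (le_rearrange hT hy.1.le)), hkr]

/-- A function and its decreasing rearrangement are equimeasurable. -/
theorem setLIntegral_comp_eq_rearrange {X : Type*} [MeasurableSpace X] {μ : Measure X} {f : X → ℝ}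
    (hf : Measurable f) {N : ℝ → ℝ} {A : ℝ} (hN : AntitoneOn N (Set.Ici A))
    (hT : ∃ T, A ≤ T ∧ N T = 0)
    (hr : ∀ t, A ≤ t → ∀ y, (∀ t' > t, N t' ≤ y) → N t ≤ y)
    (hμ : ∀ t, A ≤ t → μ {x | t < f x} = ENNReal.ofReal (N t)) {g : ℝ → ℝ≥0∞}
    (hg : Measurable g) :
    ∫⁻ x in {x | A < f x}, g (f x) ∂μ =
      ∫⁻ y in Set.Ioo 0 (N A), g (rearrange N A y) := by
  have hR : AEMeasurable (rearrange N A) (volume.restrict (Set.Ioo 0 (N A))) :=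
    aemeasurable_restrict_of_antitoneOn measurableSet_Ioo
      fun y hy y' _ hyy => rearrange_antitone hT hy.1.le hyy
  have hfin : IsFiniteMeasure (μ.restrict {x | A < f x}) :=
    ⟨by rw [Measure.restrict_apply_univ, hμ A le_rfl]; exact ENNReal.ofReal_lt_top⟩
  have huniv : (μ.restrict {x | A < f x}).map f Set.univ =
      (volume.restrict (Set.Ioo 0 (N A))).map (rearrange N A) Set.univ := by
    rw [Measure.map_apply hf MeasurableSet.univ, Measure.map_apply_of_aemeasurable hR
      MeasurableSet.univ]
    simp [hμ A le_rfl]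
  have hmap : (μ.restrict {x | A < f x}).map f =
      (volume.restrict (Set.Ioo 0 (N A))).map (rearrange N A) := by
    refine ext_of_generate_finite (Set.range Set.Ioi)
      (BorelSpace.measurable_eq.trans (borel_eq_generateFrom_Ioi ℝ)) isPiSystem_Ioi ?_ huniv
    rintro _ ⟨t, rfl⟩
    rw [Measure.map_apply hf measurableSet_Ioi, Measure.map_apply_of_aemeasurable hR
      measurableSet_Ioi, Measure.restrict_apply (hf measurableSet_Ioi),
      Measure.restrict_apply' measurableSet_Ioo]
    have h1 : f ⁻¹' Set.Ioi t ∩ {x | A < f x} = {x | max A t < f x} := by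
      ext x
      simp [and_comm]
    have hNt : N (max A t) ≤ N A := hN Set.self_mem_Ici (le_max_left A t) (le_max_left A t)
    have h2 : volume (rearrange N A ⁻¹' Set.Ioi t ∩ Set.Ioo 0 (N A)) =
        volume (Set.Ioo 0 (N (max A t))) := by
      rcases le_or_gt A t with hAt | hAt
      · congr 1
        rw [max_eq_right hAt] at hNt ⊢
        ext y
        constructor
        · rintro ⟨hy, hy0, -⟩
          exact ⟨hy0, (lt_rearrange_iff hN hT hr hy0.le hAt).1 hy⟩
        · rintro ⟨hy0, hy⟩
          exact ⟨(lt_rearrange_iff hN hT hr hy0.le hAt).2 hy, hy0, hy.trans_le hNt⟩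
      · congr 1
        rw [max_eq_left hAt.le]
        refine Set.inter_eq_right.2 fun y hy => ?_
        exact hAt.trans_le (le_rearrange hT hy.1.le)
    rw [h1, h2, hμ _ (le_max_left A t), Real.volume_Ioo, sub_zero]
  rw [← lintegral_map hg hf, hmap, lintegral_map' hg.aemeasurable hR]

section

variable {m : ℕ}

local notation "E" => EuclideanSpace ℝ (Fin (m + 2))

theorem measure_lt_abs_ne_top {u : E → ℝ} (hu : Continuous u) (hc : HasCompactSupport u) {t : ℝ}
    (ht : 0 < t) : volume {x | t < |u x|} ≠ ∞ :=
  measure_ne_top_of_subset (fun x (hx : t < |u x|) => hx.le) (isCompact_le_abs hu hc ht).measure_ne_top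

theorem measureReal_lt_abs_le_of_forall_gt {u : E → ℝ} (hu : Continuous u) {t y : ℝ}
    (h : ∀ t' > t, volume.real {x | t' < |u x|} ≤ y) (hc : HasCompactSupport u) (ht : 0 < t) :
    volume.real {x | t < |u x|} ≤ y := by
  have hy : 0 ≤ y := measureReal_nonneg.trans (h (t + 1) (by simp))
  refine ENNReal.toReal_le_of_le_ofReal hy ?_
  have hU : {x | t < |u x|} = ⋃ k : ℕ, {x | t + 1 / ((k : ℝ) + 1) < |u x|} := by
    ext x
    simp only [Set.mem_ofPred_eq, Set.mem_iUnion]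
    constructor
    · intro hx
      obtain ⟨k, hk⟩ := exists_nat_one_div_lt (sub_pos.2 hx)
      exact ⟨k, by linarith⟩
    · rintro ⟨k, hk⟩
      have : (0 : ℝ) < 1 / ((k : ℝ) + 1) := by positivity
      linarith
  rw [hU, Monotone.measure_iUnion]
  · refine iSup_le fun k => ?_
    have hk : (0 : ℝ) < 1 / ((k : ℝ) + 1) := by positivity
    refine (ENNReal.le_ofReal_iff_toReal_le ?_ hy).2 (h _ (by linarith))
    exact measure_lt_abs_ne_top hu hc (by linarith)
  · intro k l hkl x hx
    have : 1 / ((l : ℝ) + 1) ≤ 1 / ((k : ℝ) + 1) := by gcongr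
    simp only [Set.mem_ofPred_eq] at hx ⊢
    linarith

theorem integrable_norm_fderiv_pow {u : E → ℝ} (hu : ContDiff ℝ 1 u) (hc : HasCompactSupport u)
    (k : ℕ) (hk : k ≠ 0) : Integrable fun x => ‖fderiv ℝ u x‖ ^ k := by
  refine Continuous.integrable_of_hasCompactSupport
    ((hu.continuous_fderiv one_ne_zero).norm.pow k) ?_
  exact (hc.fderiv (𝕜 := ℝ)).comp_left (g := fun L => ‖L‖ ^ k) (by simp [hk])

theorem sub_pow_mul_measureReal_le {u : E → ℝ} (hu : ContDiff ℝ 1 u) (hc : HasCompactSupport u)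
    {B : ℝ} (hB : 0 < B) (hBn : ENNReal.ofReal (B ^ (m + 2)) = volume (Metric.ball (0 : E) 1))
    {a b : ℝ} (ha : 0 < a) (hab : a ≤ b) :
    (b - a) ^ (m + 2) * ((m + 2) * B) ^ (m + 2) * volume.real {x | b < |u x|} ^ (m + 1) ≤
      ((∫ x in {x | a < |u x|}, ‖fderiv ℝ u x‖ ^ (m + 2)) -
        ∫ x in {x | b < |u x|}, ‖fderiv ℝ u x‖ ^ (m + 2)) *
      (volume.real {x | a < |u x|} - volume.real {x | b < |u x|}) ^ (m + 1) := by
  set S := {x | a < |u x| ∧ |u x| ≤ b} with hS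
  set Na := {x | a < |u x|} with hNa
  set Nb := {x | b < |u x|} with hNb
  have hba : Nb ⊆ Na := fun x hx => hab.trans_lt hx
  have hSd : S = Na \ Nb := by
    ext x
    simp [hS, hNa, hNb]
  have mNb : MeasurableSet Nb := measurableSet_lt measurable_const hu.continuous.abs.measurable
  have mNa : MeasurableSet Na := measurableSet_lt measurable_const hu.continuous.abs.measurable
  have mS : MeasurableSet S := hSd ▸ mNa.diff mNb
  have fNa : volume Na ≠ ∞ := measure_lt_abs_ne_top hu.continuous hc ha
  have fNb : volume Nb ≠ ∞ := measure_lt_abs_ne_top hu.continuous hc (ha.trans_le hab)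
  have fS : volume S ≠ ∞ := measure_ne_top_of_subset (fun x hx => hx.1) fNa
  have hDu := integrable_norm_fderiv_pow hu hc (m + 2) (by omega)
  have e1 : volume.real Na - volume.real Nb = volume.real S := by
    rw [hSd, measureReal_sdiff hba mNb fNa]
  have e2 : (∫ x in Na, ‖fderiv ℝ u x‖ ^ (m + 2)) - ∫ x in Nb, ‖fderiv ℝ u x‖ ^ (m + 2) =
      ∫ x in S, ‖fderiv ℝ u x‖ ^ (m + 2) := by
    rw [hSd, setIntegral_sdiff mNb hDu.integrableOn hba]
  rw [e1, e2]
  have hI0 : 0 ≤ ∫ x in S, ‖fderiv ℝ u x‖ ^ (m + 2) := integral_nonneg fun x => by positivity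
  set κ : ℝ := volume.real Nb ^ (((m + 2 : ℕ) : ℝ)⁻¹) with hκ
  have hκ0 : 0 ≤ κ := Real.rpow_nonneg measureReal_nonneg _
  have hκn : κ ^ (m + 2) = volume.real Nb := Real.rpow_inv_natCast_pow measureReal_nonneg (by simp)
  have h1 := ofReal_mul_le_setLIntegral_norm_fderiv hu hc hκ0 hB hBn (b := b) ha (by
    rw [hκn, measureReal_def, ENNReal.ofReal_toReal fNb]
    exact measure_mono fun x (hx : b < |u x|) => hx.le)
  have hmeas : Measurable fun x => ENNReal.ofReal ‖fderiv ℝ u x‖ :=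
    (hu.continuous_fderiv one_ne_zero).norm.measurable.ennreal_ofReal
  have h2 := (pow_le_pow_left' h1 (m + 2)).trans (setLIntegral_pow_le hmeas S m)
  have h3 : ∫⁻ x in S, ENNReal.ofReal ‖fderiv ℝ u x‖ ^ (m + 2) =
      ENNReal.ofReal (∫ x in S, ‖fderiv ℝ u x‖ ^ (m + 2)) := by
    rw [ofReal_integral_eq_lintegral_ofReal hDu.integrableOn
      (Filter.Eventually.of_forall fun x => by positivity)]
    exact lintegral_congr fun x => (ENNReal.ofReal_pow (norm_nonneg _) _).symm
  rw [h3, ← ENNReal.ofReal_toReal fS, ← measureReal_def, ← ENNReal.ofReal_pow (by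
    have := sub_nonneg.2 hab; positivity), ← ENNReal.ofReal_pow measureReal_nonneg,
    ← ENNReal.ofReal_mul hI0, ENNReal.ofReal_le_ofReal_iff (by positivity)] at h2
  refine le_trans (le_of_eq ?_) h2
  rw [← hκn, ← pow_mul, mul_comm (m + 2) (m + 1), pow_mul, ← mul_pow, ← mul_pow, mul_assoc]

end

/-- The Moser–Trudinger inequality on a superlevel set of measure at most one. -/
theorem exists_setLIntegral_exp_le (m : ℕ) : ∃ C : ℝ≥0∞, C ≠ ∞ ∧
    ∀ (u : EuclideanSpace ℝ (Fin (m + 2)) → ℝ) (A c B : ℝ), ContDiff ℝ 1 u → HasCompactSupport u → 0 < B →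
      ENNReal.ofReal (B ^ (m + 2)) = volume
        (Metric.ball (0 : EuclideanSpace ℝ (Fin (m + 2))) 1) → 0 < A → 0 ≤ c →
      volume.real {x | A < |u x|} ≤ 1 → c * ∫ x, ‖fderiv ℝ u x‖ ^ (m + 2) ≤ 1 →
      ∫⁻ x in {x | A < |u x|}, ENNReal.ofReal (Real.exp
        ((c * ((m + 2) * B) ^ (m + 2)) ^ ((m : ℝ) + 1)⁻¹ *
          (|u x| - A) ^ (1 + ((m : ℝ) + 1)⁻¹))) ≤ C := by
  obtain ⟨C, hC, H⟩ := exists_lintegral_exp_rearrange_le m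
  refine ⟨C, hC, fun u A c B hu hc hB hBn hA hc0 hν hD => ?_⟩
  set N : ℝ → ℝ := fun t => volume.real {x | t < |u x|} with hN
  set G : ℝ → ℝ := fun t => ∫ x in {x | t < |u x|}, ‖fderiv ℝ u x‖ ^ (m + 2) with hG
  have hDu := integrable_norm_fderiv_pow hu hc (m + 2) (by omega)
  have hNanti : AntitoneOn N (Set.Ici A) := fun t ht t' _ htt =>
    measureReal_mono (fun x hx => lt_of_le_of_lt htt hx)
      (measure_lt_abs_ne_top hu.continuous hc (hA.trans_le ht))
  have hGanti : AntitoneOn G (Set.Ici A) := fun t _ t' _ htt =>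
    setIntegral_mono_set hDu.integrableOn (Filter.Eventually.of_forall fun x => by positivity)
      (LE.le.eventuallyLE fun x hx => lt_of_le_of_lt htt hx)
  have hT : ∃ T, A ≤ T ∧ N T = 0 := by
    obtain ⟨K, hK⟩ := hc.exists_bound_of_continuous hu.continuous
    refine ⟨max A K, le_max_left _ _, ?_⟩
    have : {x | max A K < |u x|} = ∅ := by
      ext x
      have := hK x
      rw [Real.norm_eq_abs] at this
      simp only [Set.mem_ofPred_eq, Set.mem_empty_iff_false, iff_false, not_lt]
      exact this.trans (le_max_right _ _)
    simp only [hN, this, measureReal_empty]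
  have hr : ∀ t, A ≤ t → ∀ y, (∀ t' > t, N t' ≤ y) → N t ≤ y := fun t ht y h =>
    measureReal_lt_abs_le_of_forall_gt hu.continuous h hc (hA.trans_le ht)
  have main := H N G A c (((m + 2) * B) ^ (m + 2)) hNanti hT hr hGanti
    (fun a b ha hab => sub_pow_mul_measureReal_le hu hc hB hBn (hA.trans_le ha) hab)
    hc0 (by positivity) hν (fun t => integral_nonneg fun x => by positivity)
    (le_trans (mul_le_mul_of_nonneg_left (setIntegral_le_integral hDu
      (Filter.Eventually.of_forall fun x => by positivity)) hc0) hD)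
  set g : ℝ → ℝ≥0∞ := fun t => ENNReal.ofReal (Real.exp
        ((c * ((m + 2) * B) ^ (m + 2)) ^ ((m : ℝ) + 1)⁻¹ *
          (t - A) ^ (1 + ((m : ℝ) + 1)⁻¹))) with hg
  have hgm : Measurable g := by fun_prop
  calc _ = ∫⁻ x in {x | A < |u x|}, g |u x| := rfl
    _ = ∫⁻ y in Set.Ioo 0 (N A), g (rearrange N A y) :=
      setLIntegral_comp_eq_rearrange hu.continuous.abs.measurable hNanti hT hr
        (fun t ht => (ENNReal.ofReal_toReal
          (measure_lt_abs_ne_top hu.continuous hc (hA.trans_le ht))).symm) hgm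
    _ ≤ ∫⁻ y in Set.Ioo 0 1, g (rearrange N A y) :=
      lintegral_mono_set (Set.Ioo_subset_Ioo_right hν)
    _ ≤ C := main

theorem Real.exp_sub_sum_le_pow_mul_exp {x : ℝ} (hx : 0 ≤ x) (k : ℕ) :
    Real.exp x - ∑ j ∈ Finset.range k, x ^ j / (j.factorial : ℝ) ≤ x ^ k * Real.exp x := by
  have h := Complex.norm_exp_sub_sum_le_norm_mul_exp (x : ℂ) k
  rw [Complex.norm_of_nonneg hx] at h
  refine le_trans ?_ h
  have : Complex.exp x - ∑ j ∈ Finset.range k, (x : ℂ) ^ j / (j.factorial : ℂ) =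
      ((Real.exp x - ∑ j ∈ Finset.range k, x ^ j / (j.factorial : ℝ) : ℝ) : ℂ) := by
    push_cast
    rfl
  rw [this, Complex.norm_real]
  exact le_abs_self _

theorem mul_rpow_one_add_inv_le {m : ℕ} {K A X t : ℝ} (hK : 0 ≤ K) (hA : 0 ≤ A) (hX : 0 < X)
    (hX1 : X ≤ 1) (hAX : A ^ (m + 2) = X) (ht : A ≤ t) :
    K ^ ((m : ℝ) + 1)⁻¹ * t ^ (1 + ((m : ℝ) + 1)⁻¹) ≤
      2 * K ^ ((m : ℝ) + 1)⁻¹ +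
        ((1 - X / 2)⁻¹ * K) ^ ((m : ℝ) + 1)⁻¹ * (t - A) ^ (1 + ((m : ℝ) + 1)⁻¹) := by
  set e : ℝ := ((m : ℝ) + 1)⁻¹ with he
  have he0 : 0 ≤ e := by positivity
  have he1 : e ≤ 1 := inv_le_one_of_one_le₀ (by linarith [(Nat.cast_nonneg m : (0 : ℝ) ≤ m)])
  have hp : 0 < 1 - X / 2 := by linarith
  have h1 := add_rpow_le_of_add_eq_one (sub_nonneg.2 ht) hA hp (half_pos hX)
    (sub_add_cancel 1 (X / 2)) he0
  rw [sub_add_cancel] at h1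
  have h2 : A ^ (1 + e) ≤ X ^ e * 1 :=
    rpow_one_add_inv_le hA hX.le zero_le_one (by simp [hAX])
  have h3 : (X / 2) ^ (-e) * A ^ (1 + e) ≤ 2 := by
    calc (X / 2) ^ (-e) * A ^ (1 + e) ≤ (X / 2) ^ (-e) * (X ^ e * 1) := by gcongr
      _ = (2 : ℝ) ^ e := by
        rw [mul_one, Real.rpow_neg (half_pos hX).le, Real.div_rpow hX.le zero_le_two]
        field_simp
      _ ≤ (2 : ℝ) ^ (1 : ℝ) := Real.rpow_le_rpow_of_exponent_le one_le_two he1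
      _ = 2 := Real.rpow_one 2
  have hKe : 0 ≤ K ^ e := Real.rpow_nonneg hK e
  rw [Real.mul_rpow (inv_nonneg.2 hp.le) hK, Real.inv_rpow hp.le, ← Real.rpow_neg hp.le]
  calc K ^ e * t ^ (1 + e)
      ≤ K ^ e * ((1 - X / 2) ^ (-e) * (t - A) ^ (1 + e) + (X / 2) ^ (-e) * A ^ (1 + e)) := by gcongr
    _ ≤ K ^ e * ((1 - X / 2) ^ (-e) * (t - A) ^ (1 + e) + 2) := by gcongr
    _ = _ := by ring

/-- The Moser–Trudinger inequality on the whole space, with the full Sobolev norm. -/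
theorem exists_lintegral_exp_sub_sum_le (m : ℕ) {B α : ℝ} (hB : 0 < B)
    (hBn : ENNReal.ofReal (B ^ (m + 2)) =
      volume (Metric.ball (0 : EuclideanSpace ℝ (Fin (m + 2))) 1))
    (hα : α = (((m + 2) * B) ^ (m + 2)) ^ ((m : ℝ) + 1)⁻¹) :
    ∃ d : ℝ, 0 < d ∧ ∀ u : EuclideanSpace ℝ (Fin (m + 2)) → ℝ,
      ContDiff ℝ 1 u → HasCompactSupport u →
      (∫ x, (‖fderiv ℝ u x‖ ^ (m + 2) + |u x| ^ (m + 2))) ≤ 1 →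
      ∫⁻ x, ENNReal.ofReal (Real.exp (α * |u x| ^ (1 + ((m : ℝ) + 1)⁻¹)) -
        ∑ j ∈ Finset.range (m + 1),
          (α * |u x| ^ (1 + ((m : ℝ) + 1)⁻¹)) ^ j / (j.factorial : ℝ)) ≤ ENNReal.ofReal d := by
  obtain ⟨C, hC, H⟩ := exists_setLIntegral_exp_le m
  set e : ℝ := ((m : ℝ) + 1)⁻¹ with he
  have he0 : 0 ≤ e := by positivity
  set K : ℝ := ((m + 2) * B) ^ (m + 2) with hK
  have hK0 : 0 ≤ K := by positivity
  have hα0 : 0 ≤ α := hα ▸ Real.rpow_nonneg hK0 _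
  refine ⟨α ^ (m + 1) * Real.exp α + Real.exp (2 * α) * C.toReal + 1, by positivity,
    fun u hu hc hle => ?_⟩
  set Φ : ℝ → ℝ := fun t => Real.exp (α * t ^ (1 + e)) -
    ∑ j ∈ Finset.range (m + 1), (α * t ^ (1 + e)) ^ j / (j.factorial : ℝ) with hΦ
  change ∫⁻ x, ENNReal.ofReal (Φ |u x|) ≤ _
  have hupow : Integrable fun x => |u x| ^ (m + 2) :=
    (hu.continuous.abs.pow _).integrable_of_hasCompactSupport
      (hc.comp_left (g := fun t => |t| ^ (m + 2)) (by simp))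
  have hDpow := integrable_norm_fderiv_pow hu hc (m + 2) (by omega)
  rw [integral_add hDpow hupow] at hle
  set X := ∫ x, |u x| ^ (m + 2) with hX
  set D := ∫ x, ‖fderiv ℝ u x‖ ^ (m + 2) with hD
  have hX0 : 0 ≤ X := integral_nonneg fun x => by positivity
  have hD0 : 0 ≤ D := integral_nonneg fun x => by positivity
  rcases hX0.eq_or_lt with hX00 | hXpos
  · have hae := (integral_eq_zero_iff_of_nonneg (fun x => by positivity) hupow).1 hX00.symm
    refine le_trans (le_of_eq ?_) zero_le
    rw [← lintegral_zero (μ := (volume : Measure (EuclideanSpace ℝ (Fin (m + 2)))))]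
    refine lintegral_congr_ae ?_
    filter_upwards [hae] with x hx
    have hx0 : |u x| = 0 := by simpa using hx
    have he1 : 1 + e ≠ 0 := by positivity
    simp [hΦ, hx0, Real.zero_rpow he1, Finset.sum_range_succ']
  set A : ℝ := X ^ (((m + 2 : ℕ) : ℝ)⁻¹) with hA
  have hA0 : 0 < A := Real.rpow_pos_of_pos hXpos _
  have hAX : A ^ (m + 2) = X := Real.rpow_inv_natCast_pow hX0 (by simp)
  have hX1 : X ≤ 1 := by linarith
  have hA1 : A ≤ 1 := Real.rpow_le_one hX0 hX1 (by positivity)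
  have hν : volume.real {x | A < |u x|} ≤ 1 := by
    have h1 := mul_meas_ge_le_integral_of_nonneg
      (Filter.Eventually.of_forall fun x => by positivity) hupow X
    have hset : {x | X ≤ |u x| ^ (m + 2)} = {x | A ≤ |u x|} := by
      ext x
      simp only [Set.mem_ofPred_eq, ← hAX]
      exact pow_le_pow_iff_left₀ hA0.le (abs_nonneg _) (by omega)
    rw [hset] at h1
    have h2 : volume.real {x | A ≤ |u x|} ≤ 1 :=
      le_of_mul_le_mul_left (h1.trans_eq (mul_one X).symm) hXpos
    exact (measureReal_mono (fun x (hx : A < |u x|) => hx.le)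
      (isCompact_le_abs hu.continuous hc hA0).measure_ne_top).trans h2
  have hp : 0 < 1 - X / 2 := by linarith
  have hcD : (1 - X / 2)⁻¹ * D ≤ 1 := by
    rw [inv_mul_le_iff₀ hp]
    linarith
  have hlarge := H u A (1 - X / 2)⁻¹ B hu hc hB hBn hA0 (inv_nonneg.2 hp.le) hν hcD
  have hmeas : MeasurableSet {x | A < |u x|} :=
    measurableSet_lt measurable_const hu.continuous.abs.measurable
  rw [← lintegral_add_compl _ hmeas]
  have b1 : ∫⁻ x in {x | A < |u x|}, ENNReal.ofReal (Φ |u x|) ≤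
      ENNReal.ofReal (Real.exp (2 * α) * C.toReal) := by
    calc _ ≤ ∫⁻ x in {x | A < |u x|}, ENNReal.ofReal (Real.exp (2 * α)) *
          ENNReal.ofReal (Real.exp (((1 - X / 2)⁻¹ * K) ^ e * (|u x| - A) ^ (1 + e))) := by
          refine setLIntegral_mono' hmeas fun x (hx : A < |u x|) => ?_
          rw [← ENNReal.ofReal_mul (Real.exp_nonneg _), ← Real.exp_add]
          refine ENNReal.ofReal_le_ofReal ?_
          refine (sub_le_self _ (Finset.sum_nonneg fun j _ => by positivity)).trans ?_
          have := mul_rpow_one_add_inv_le hK0 hA0.le hXpos hX1 hAX hx.le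
          rw [← he, ← hα] at this
          exact Real.exp_le_exp.2 this
      _ = ENNReal.ofReal (Real.exp (2 * α)) * ∫⁻ x in {x | A < |u x|},
          ENNReal.ofReal (Real.exp (((1 - X / 2)⁻¹ * K) ^ e * (|u x| - A) ^ (1 + e))) :=
          lintegral_const_mul' _ _ ENNReal.ofReal_ne_top
      _ ≤ ENNReal.ofReal (Real.exp (2 * α)) * C := by gcongr
      _ = _ := by
          rw [ENNReal.ofReal_mul (Real.exp_nonneg _), ENNReal.ofReal_toReal hC]
  have b2 : ∫⁻ x in {x | A < |u x|}ᶜ, ENNReal.ofReal (Φ |u x|) ≤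
      ENNReal.ofReal (α ^ (m + 1) * Real.exp α) := by
    calc _ ≤ ∫⁻ x in {x | A < |u x|}ᶜ,
          ENNReal.ofReal (α ^ (m + 1) * Real.exp α) * ENNReal.ofReal (|u x| ^ (m + 2)) := by
          refine setLIntegral_mono' hmeas.compl fun x (hx : ¬ A < |u x|) => ?_
          rw [← ENNReal.ofReal_mul (by positivity)]
          refine ENNReal.ofReal_le_ofReal ?_
          have ht1 : |u x| ^ (1 + e) ≤ 1 :=
            Real.rpow_le_one (abs_nonneg _) ((not_lt.1 hx).trans hA1) (by positivity)
          have hτ : α * |u x| ^ (1 + e) ≤ α := mul_le_of_le_one_right hα0 ht1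
          calc Φ |u x| ≤ (α * |u x| ^ (1 + e)) ^ (m + 1) * Real.exp (α * |u x| ^ (1 + e)) :=
                Real.exp_sub_sum_le_pow_mul_exp (by positivity) _
            _ ≤ (α * |u x| ^ (1 + e)) ^ (m + 1) * Real.exp α := by gcongr
            _ = _ := by rw [mul_pow, rpow_one_add_inv_pow (abs_nonneg _)]; ring
      _ ≤ ∫⁻ x, ENNReal.ofReal (α ^ (m + 1) * Real.exp α) * ENNReal.ofReal (|u x| ^ (m + 2)) :=
          setLIntegral_le_lintegral _ _
      _ = ENNReal.ofReal (α ^ (m + 1) * Real.exp α) * ENNReal.ofReal X := by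
          rw [lintegral_const_mul' _ _ ENNReal.ofReal_ne_top, hX,
            ofReal_integral_eq_lintegral_ofReal hupow
              (Filter.Eventually.of_forall fun x => by positivity)]
      _ ≤ _ := mul_le_of_le_one_right' (ENNReal.ofReal_le_one.2 hX1)
  refine (add_le_add b1 b2).trans ?_
  rw [← ENNReal.ofReal_add (by positivity) (by positivity)]
  exact ENNReal.ofReal_le_ofReal (by linarith)

end

theorem stmt_17 (n : ℕ) (hn : 2 ≤ n) (α : ℝ)
    (hα : α = n * (n * (volume (Metric.ball (0 : EuclideanSpace ℝ (Fin n)) 1)).toReal) ^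
      ((1 : ℝ) / ((n : ℝ) - 1))) :
    ∃ d : ℝ, 0 < d ∧
      ∀ Ω : Set (EuclideanSpace ℝ (Fin n)), IsOpen Ω →
        ∀ u : EuclideanSpace ℝ (Fin n) → ℝ, ContDiff ℝ (⊤ : ℕ∞) u → HasCompactSupport u →
          tsupport u ⊆ Ω →
          (∫ x in Ω, (‖fderiv ℝ u x‖ ^ n + |u x| ^ n)) ≤ 1 →
          (∫ x in Ω, (Real.exp (α * |u x| ^ ((n : ℝ) / ((n : ℝ) - 1))) -
            ∑ j ∈ Finset.range (n - 1),
              (α * |u x| ^ ((n : ℝ) / ((n : ℝ) - 1))) ^ j / (j.factorial : ℝ))) ≤ d := by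
  obtain ⟨m, rfl⟩ := Nat.exists_eq_add_of_le' hn
  set V := volume (Metric.ball (0 : EuclideanSpace ℝ (Fin (m + 2))) 1) with hV
  have hVtop : V ≠ ⊤ := measure_ball_lt_top.ne
  have hV0 : 0 < V.toReal := ENNReal.toReal_pos (Metric.measure_ball_pos _ _ one_pos).ne' hVtop
  set B : ℝ := V.toReal ^ (((m + 2 : ℕ) : ℝ)⁻¹) with hBdef
  have hB : 0 < B := Real.rpow_pos_of_pos hV0 _
  have hBn : B ^ (m + 2) = V.toReal := Real.rpow_inv_natCast_pow hV0.le (by simp)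
  have hm : (m : ℝ) + 1 ≠ 0 := by positivity
  have e1 : (((m + 2 : ℕ) : ℝ) - 1) = (m : ℝ) + 1 := by push_cast; ring
  have e2 : ((m + 2 : ℕ) : ℝ) / (((m + 2 : ℕ) : ℝ) - 1) = 1 + ((m : ℝ) + 1)⁻¹ := by
    rw [e1]
    push_cast
    field_simp
    ring
  have hα' : α = (((m + 2) * B) ^ (m + 2)) ^ ((m : ℝ) + 1)⁻¹ := by
    have hr : (((m : ℝ) + 2) ^ (m + 1)) ^ ((m : ℝ) + 1)⁻¹ = (m : ℝ) + 2 := by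
      have : ((m : ℝ) + 1) = ((m + 1 : ℕ) : ℝ) := by push_cast; rfl
      rw [this, Real.pow_rpow_inv_natCast (by positivity) (by simp)]
    rw [hα, e1, mul_pow, hBn, pow_succ ((m : ℝ) + 2) (m + 1), mul_assoc,
      Real.mul_rpow (x := ((m : ℝ) + 2) ^ (m + 1)) (by positivity) (by positivity), hr, one_div]
    push_cast
    rfl
  obtain ⟨d, hd, h⟩ := exists_lintegral_exp_sub_sum_le m hB
    (by rw [hBn, ENNReal.ofReal_toReal hVtop]) hα'
  refine ⟨d, hd, fun Ω _ u hu hc hΩ hle => ?_⟩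
  have hα0 : 0 ≤ α := by rw [hα']; positivity
  rw [setIntegral_eq_integral_of_forall_compl_eq_zero] at hle
  · rw [e2, Nat.add_sub_assoc one_le_two]
    rw [integral_eq_lintegral_of_nonneg_ae]
    · exact ENNReal.toReal_le_of_le_ofReal hd.le ((setLIntegral_le_lintegral _ _).trans
        (h u (hu.of_le (by exact_mod_cast le_top)) hc hle))
    · refine Filter.Eventually.of_forall fun x => sub_nonneg.2 ?_
      exact Real.sum_le_exp_of_nonneg (by positivity) _
    · have hpos : 0 ≤ 1 + ((m : ℝ) + 1)⁻¹ := by positivity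
      have hc' : Continuous fun x => α * |u x| ^ (1 + ((m : ℝ) + 1)⁻¹) :=
        continuous_const.mul (hu.continuous.abs.rpow_const fun x => Or.inr hpos)
      exact Continuous.aestronglyMeasurable (by fun_prop)
  · intro x hx
    have hx' : x ∉ tsupport u := fun h => hx (hΩ h)
    have h1 : u x = 0 := image_eq_zero_of_notMem_tsupport hx'
    have h2 : fderiv ℝ u x = 0 :=
      image_eq_zero_of_notMem_tsupport fun h => hx' (tsupport_fderiv_subset ℝ h)
    simp [h1, h2]
end
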